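/- arXiv:1910.13853 — 2 statements merged into one kernel-verified Lean document; each statement's English description precedes it below -/
import Mathlib

section
/- Let N be a level-2 phylogenetic network on X with |X| ≥ 3, let x be a leaf of N that is not contained in a blob, and let Y ∪ Z be the unique partition of X' = X \ {x} induced by x (i.e., the unique partition into non-empty sets with d_m(y,z) = d_m(x,y) + d_m(x,z) − 2 for all y ∈ Y, z ∈ Z). Let N' be the network on X' obtained from N by deleting the leaf x (removing x and its incident edge and suppressing the resulting degree-2 vertex). Then d^{N'}(y,z) = d^{N}(y,z) if y, z ∈ Y or y, z ∈ Z, and d^{N'}(y,z) = d^{N}(y,z) − 1 if one of y, z is in Y and the other is in Z. Moreover, there is exactly one edge of N' such that reattaching x to that edge yields a network with the same multisets of distances as N, and the resulting network is isomorphic to N. -/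
open SimpleGraph

/-- A labelled graph: the raw data of a phylogenetic network on a label set `X`:
a finite vertex type, a simple graph on it, and a labelling map from `X` to vertices. -/
structure LabGraph (X : Type) where
  V : Type
  [fV : Fintype V]
  G : SimpleGraph V
  leaf : X → V

attribute [instance] LabGraph.fV

namespace LabGraph

variable {X : Type} [Fintype X] [DecidableEq X]

/-- The shortest distance `d_m(x,y)` between the leaves labelled `x` and `y`. -/
noncomputable def dm (N : LabGraph X) (x y : X) : ℕ :=
  N.G.dist (N.leaf x) (N.leaf y)

/-- The multiset `d(x,y)` of the lengths of all paths between the leaves `x` and `y`. -/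
noncomputable def dms (N : LabGraph X) (x y : X) : Multiset ℕ := by
  classical
  exact (Finset.univ : Finset (N.G.Path (N.leaf x) (N.leaf y))).val.map fun p => p.1.length

/-- The degree of a vertex. -/
noncomputable def degOf (N : LabGraph X) (v : N.V) : ℕ := (N.G.neighborSet v).ncard

/-- `N` is an (unweighted unrooted binary) phylogenetic network on `X`:
it is connected, the labelling is injective, and either it is the singleton graph
(when `|X| = 1`), or every leaf-labelled vertex has degree 1 and every other
vertex has degree 3 (so the degree-1 vertices are exactly the labelled leaves). -/
def IsNetwork (N : LabGraph X) : Prop :=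
  N.G.Connected ∧ Function.Injective N.leaf ∧
    ((Fintype.card X = 1 ∧ Fintype.card N.V = 1) ∨
      ((∀ x : X, N.degOf (N.leaf x) = 1) ∧
        ∀ v : N.V, v ∉ Set.range N.leaf → N.degOf v = 3))

/-- Two labelled graphs on `X` are isomorphic by a graph isomorphism fixing the leaf labels. -/
def IsomLabelled (N M : LabGraph X) : Prop :=
  ∃ φ : N.G ≃g M.G, ∀ x : X, φ (N.leaf x) = M.leaf x

/-- A subgraph is 2-connected (with at least three vertices): it is connected and
remains connected after deleting any one of its vertices. -/
def TwoConnSub (N : LabGraph X) (H : N.G.Subgraph) : Prop :=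
  3 ≤ H.verts.ncard ∧ H.coe.Connected ∧
    ∀ v ∈ H.verts, (H.deleteVerts {v}).coe.Connected

/-- A blob: a maximal 2-connected subgraph with at least three vertices. -/
def IsBlob (N : LabGraph X) (H : N.G.Subgraph) : Prop :=
  N.TwoConnSub H ∧ ∀ H' : N.G.Subgraph, N.TwoConnSub H' → H ≤ H' → H' = H

/-- Exactly `r` edges must be deleted from the (connected) subgraph `H` to obtain a
tree: `|E(H)| - |V(H)| + 1 = r`.  A level-1 blob has rank 1, a level-2 blob rank 2. -/
def BlobRank (N : LabGraph X) (H : N.G.Subgraph) (r : ℕ) : Prop :=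
  H.edgeSet.ncard + 1 = H.verts.ncard + r

/-- A network is level-`k` if at most `k` edges must be deleted from every blob
to obtain a tree. -/
def IsLevel (N : LabGraph X) (k : ℕ) : Prop :=
  ∀ H : N.G.Subgraph, N.IsBlob H → H.edgeSet.ncard + 1 ≤ H.verts.ncard + k

/-- A cut-edge: an edge whose deletion disconnects the graph. -/
def IsCutEdge (N : LabGraph X) (e : Sym2 N.V) : Prop :=
  e ∈ N.G.edgeSet ∧ ¬ (N.G.deleteEdges {e}).Connected

/-- A trivial (cut-)edge: one incident to a leaf. -/
def TrivialEdge (N : LabGraph X) (e : Sym2 N.V) : Prop :=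
  ∃ x : X, N.leaf x ∈ e

/-- An edge is incident to a blob if one of its endpoints is a vertex of the blob. -/
def EdgeIncBlob (N : LabGraph X) (e : Sym2 N.V) (H : N.G.Subgraph) : Prop :=
  ∃ v ∈ H.verts, v ∈ e

/-- A pendant blob: a blob with exactly one incident non-trivial cut-edge. -/
def IsPendantBlob (N : LabGraph X) (H : N.G.Subgraph) : Prop :=
  N.IsBlob H ∧
    ∃! e : Sym2 N.V, N.IsCutEdge e ∧ ¬ N.TrivialEdge e ∧ N.EdgeIncBlob e H

/-- A leaf is contained in a blob if its neighbour is a vertex of the blob. -/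
def LeafInBlob (N : LabGraph X) (x : X) (H : N.G.Subgraph) : Prop :=
  ∃ v : N.V, N.G.Adj (N.leaf x) v ∧ v ∈ H.verts

/-- `N` has at least two blobs. -/
def TwoBlobs (N : LabGraph X) : Prop :=
  ∃ H₁ H₂ : N.G.Subgraph, N.IsBlob H₁ ∧ N.IsBlob H₂ ∧ H₁ ≠ H₂

/-- Every leaf of `N` is contained in a blob. -/
def AllLeavesInBlobs (N : LabGraph X) : Prop :=
  ∀ x : X, ∃ H : N.G.Subgraph, N.IsBlob H ∧ N.LeafInBlob x H

/-- A chain: a `k`-tuple of leaves with consecutive shortest distances equal to 3. -/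
def IsChainT (N : LabGraph X) (k : ℕ) (a : Fin k → X) : Prop :=
  ∀ (i : ℕ) (h : i + 1 < k),
    N.dm (a ⟨i, Nat.lt_of_succ_lt h⟩) (a ⟨i + 1, h⟩) = 3

/-- A maximal chain: a chain whose leaf set is not properly contained in the leaf
set of another chain. -/
def IsMaxChainT (N : LabGraph X) (k : ℕ) (a : Fin k → X) : Prop :=
  N.IsChainT k a ∧ ∀ (l : ℕ) (b : Fin l → X), N.IsChainT l b →
    Set.range a ⊆ Set.range b → Set.range a = Set.range b

/-- The chain `a` is contained in the blob `H`: the edges between the neighbours of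
consecutive chain leaves are edges of `H`. -/
def ChainInBlob (N : LabGraph X) (k : ℕ) (a : Fin k → X) (H : N.G.Subgraph) : Prop :=
  ∀ (i : ℕ) (h : i + 1 < k) (p q : N.V),
    N.G.Adj (N.leaf (a ⟨i, Nat.lt_of_succ_lt h⟩)) p →
    N.G.Adj (N.leaf (a ⟨i + 1, h⟩)) q → H.Adj p q

/-- The multiset of natural numbers `A`, viewed in `ℤ`. -/
def toZ (A : Multiset ℕ) : Multiset ℤ := A.map (fun t => (t : ℤ))

/-- `A - n`: subtract `n` from every element of the multiset `A` (in `ℤ`). -/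
def zsub (A : Multiset ℕ) (n : ℤ) : Multiset ℤ := A.map (fun t => (t : ℤ) - n)

/-- `Y ∪ Z` is a partition of `X \ {x}` into two non-empty parts such that
`d_m(y,z) = d_m(x,y) + d_m(x,z) - 2` for all `y ∈ Y` and `z ∈ Z`. -/
def GoodPartition (N : LabGraph X) (x : X) (Y Z : Set X) : Prop :=
  Y ∪ Z = {x}ᶜ ∧ Y ∩ Z = ∅ ∧ Y ≠ ∅ ∧ Z ≠ ∅ ∧
    ∀ y ∈ Y, ∀ z ∈ Z, N.dm y z + 2 = N.dm x y + N.dm x z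

/-- Delete the leaf `x` (whose neighbour is `p`): remove `x` and its incident edge,
and suppress the resulting degree-2 vertex `p` (joining its two other neighbours). -/
noncomputable def leafDelete (N : LabGraph X) (x : X) (p : N.V)
    (hmem : ∀ a : X, a ≠ x → N.leaf a ≠ N.leaf x ∧ N.leaf a ≠ p) :
    LabGraph {a : X // a ≠ x} where
  V := {v : N.V // v ≠ N.leaf x ∧ v ≠ p}
  fV := by classical exact inferInstance
  G := SimpleGraph.fromRel
    (fun v₁ v₂ => N.G.Adj v₁.1 v₂.1 ∨ (N.G.Adj v₁.1 p ∧ N.G.Adj v₂.1 p))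
  leaf := fun a => ⟨N.leaf a.1, (hmem a.1 a.2).1, (hmem a.1 a.2).2⟩

/-- Reattach the leaf `x` to the edge `uv` of `M`: subdivide `uv` by a new vertex
(`Sum.inr 0`) and attach to it a new leaf (`Sum.inr 1`) labelled `x`. -/
noncomputable def reattach (x : X) (M : LabGraph {a : X // a ≠ x})
    (u v : M.V) : LabGraph X where
  V := M.V ⊕ Fin 2
  fV := inferInstance
  G := SimpleGraph.fromRel (fun w₁ w₂ =>
    (∃ a b : M.V, w₁ = Sum.inl a ∧ w₂ = Sum.inl b ∧ M.G.Adj a b ∧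
      ¬(a = u ∧ b = v) ∧ ¬(a = v ∧ b = u)) ∨
    (∃ a : M.V, w₁ = Sum.inl a ∧ w₂ = Sum.inr 0 ∧ (a = u ∨ a = v)) ∨
    (w₁ = Sum.inr 0 ∧ w₂ = Sum.inr 1))
  leaf := fun b => if h : b = x then Sum.inr 1 else Sum.inl (M.leaf ⟨b, h⟩)


/-! ### Auxiliary graph theory -/

/-- The only possible edge leaving `S` is `s t`. -/
def SE {V : Type} (G : SimpleGraph V) (S : Set V) (s t : V) : Prop :=
  s ∈ S ∧ t ∉ S ∧ ∀ a b, a ∈ S → b ∉ S → G.Adj a b → a = s ∧ b = t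

theorem SE.compl {V : Type} {G : SimpleGraph V} {S : Set V} {s t : V} (h : SE G S s t) :
    SE G Sᶜ t s := by
  refine ⟨h.2.1, fun h' => h' h.1, fun a b ha hb hab => ?_⟩
  have hb' : b ∈ S := not_not.1 hb
  have := h.2.2 b a hb' ha hab.symm
  exact ⟨this.2, this.1⟩

theorem walk_dart_split {V : Type} {G : SimpleGraph V} {u v : V} (w : G.Walk u v)
    (d : G.Dart) (hd : d ∈ w.darts) :
    ∃ (p₁ : G.Walk u d.fst) (p₂ : G.Walk d.snd v), w = p₁.append (Walk.cons d.adj p₂) := by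
  induction w with
  | nil => simp at hd
  | cons h q ih =>
    rw [Walk.darts_cons, List.mem_cons] at hd
    rcases hd with rfl | hd
    · exact ⟨Walk.nil, q, rfl⟩
    · obtain ⟨p₁, p₂, e⟩ := ih hd
      exact ⟨Walk.cons h p₁, p₂, by rw [e]; rfl⟩

theorem SE.split {V : Type} {G : SimpleGraph V} {S : Set V} {s t : V} (h : SE G S s t)
    {u v : V} (hu : u ∈ S) (hv : v ∉ S) (w : G.Walk u v) :
    ∃ (hst : G.Adj s t) (p₁ : G.Walk u s) (p₂ : G.Walk t v),
      w = p₁.append (Walk.cons hst p₂) := by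
  obtain ⟨d, hd, h1, h2⟩ := w.exists_boundary_dart S hu hv
  obtain ⟨p₁, p₂, e⟩ := walk_dart_split w d hd
  obtain ⟨⟨a, b⟩, hab⟩ := d
  obtain ⟨rfl, rfl⟩ := h.2.2 a b h1 h2 hab
  exact ⟨hab, p₁, p₂, e⟩

theorem SE.stay {V : Type} {G : SimpleGraph V} {S : Set V} {s t : V} (h : SE G S s t)
    {u v : V} (hu : u ∈ S) (hv : v ∈ S) (w : G.Walk u v) (hw : w.IsPath) :
    ∀ a ∈ w.support, a ∈ S := by
  classical
  intro a ha
  by_contra haS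
  obtain ⟨p₁, p₂, rfl⟩ : ∃ (p₁ : G.Walk u a) (p₂ : G.Walk a v), w = p₁.append p₂ :=
    ⟨_, _, (w.take_spec ha).symm⟩
  have h1 : s ∈ p₁.support := by
    obtain ⟨hst, q₁, q₂, e⟩ := h.split hu haS p₁
    rw [e]; simp
  have h2 : s ∈ p₂.support := by
    obtain ⟨hst, q₁, q₂, e⟩ := h.split hv haS p₂.reverse
    have : s ∈ p₂.reverse.support := by rw [e]; simp
    simpa using this
  have hsa : s ≠ a := fun e => haS (e ▸ h.1)
  rw [Walk.isPath_def, Walk.support_append, List.nodup_append'] at hw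
  refine hw.2.2 h1 ?_
  have := Walk.mem_support_iff p₂ |>.1 h2
  tauto

theorem SE.dist_ge {V : Type} {G : SimpleGraph V} (hG : G.Connected) {S : Set V} {s t : V}
    (h : SE G S s t) {u v : V} (hu : u ∈ S) (hv : v ∉ S) :
    G.dist u s + 1 + G.dist t v ≤ G.dist u v := by
  obtain ⟨w, hw⟩ := hG.exists_walk_length_eq_dist u v
  obtain ⟨hst, p₁, p₂, e⟩ := h.split hu hv w
  have h1 := SimpleGraph.dist_le p₁
  have h2 := SimpleGraph.dist_le p₂
  rw [← hw, e]
  simp only [Walk.length_append, Walk.length_cons]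
  omega

/-- The multiset of path lengths. -/
noncomputable def pm {V : Type} [Fintype V] (G : SimpleGraph V) (u v : V) : Multiset ℕ := by
  classical
  exact (Finset.univ : Finset (G.Path u v)).val.map fun p => p.1.length

theorem map_univ_of_bij {α β γ : Type*} [Fintype α] [Fintype β] (f : α → β)
    (hf : Function.Bijective f) (l : α → γ) (m : β → γ) (h : ∀ a, m (f a) = l a) :
    (Finset.univ : Finset α).val.map l = (Finset.univ : Finset β).val.map m := by
  have : (Finset.univ : Finset β) = Finset.univ.map ⟨f, hf.1⟩ := by
    ext b; simpa using hf.2 b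
  rw [this, Finset.map_val, Multiset.map_map]
  exact Multiset.map_congr rfl fun a _ => (h a).symm

theorem walk_lift {V W : Type} {K : SimpleGraph W} {H : SimpleGraph V} (φ : K ↪g H)
    {a b : V} (w : H.Walk a b) (hw : ∀ c ∈ w.support, c ∈ Set.range φ) :
    ∀ (u v : W) (hu : φ u = a) (hv : φ v = b),
      ∃ w' : K.Walk u v, w'.map φ.toHom = w.copy hu.symm hv.symm := by
  induction w with
  | nil =>
    intro u v hu hv
    obtain rfl := φ.injective (hu.trans hv.symm)
    subst hu
    exact ⟨Walk.nil, rfl⟩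
  | @cons a c b h q ih =>
    intro u v hu hv
    obtain ⟨c', rfl⟩ := hw c (by simp)
    obtain ⟨q', hq'⟩ := ih (fun d hd => hw d (by simp [hd])) c' v rfl hv
    subst hu
    subst hv
    refine ⟨Walk.cons (φ.map_adj_iff.1 h) q', ?_⟩
    rw [Walk.map_cons, hq']
    rfl

theorem pm_embed {V W : Type} [Fintype V] [Fintype W] {K : SimpleGraph W} {H : SimpleGraph V}
    (φ : K ↪g H) (u v : W)
    (hs : ∀ w : H.Walk (φ u) (φ v), w.IsPath → ∀ c ∈ w.support, c ∈ Set.range φ) :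
    pm K u v = pm H (φ u) (φ v) := by
  classical
  unfold pm
  refine map_univ_of_bij (fun P : K.Path u v => (P.mapEmbedding φ : H.Path (φ u) (φ v)))
    ⟨Path.mapEmbedding_injective φ u v, ?_⟩ _ _ ?_
  · rintro ⟨w, hw⟩
    obtain ⟨w', hw'⟩ := walk_lift φ w (hs w hw) u v rfl rfl
    rw [Walk.copy_rfl_rfl] at hw'
    refine ⟨⟨w', ?_⟩, Subtype.ext hw'⟩
    rw [← hw'] at hw
    exact (Walk.isPath_map_iff_of_injective φ.injective).1 hw
  · intro P
    exact Walk.length_map _ _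

theorem pm_cross {V : Type} [Fintype V] {G : SimpleGraph V} {S : Set V} {s t : V}
    (h : SE G S s t) (hst : G.Adj s t) {y z : V} (hy : y ∈ S) (hz : z ∉ S) :
    pm G y z = (pm G y s ×ˢ pm G t z).map (fun a => a.1 + a.2 + 1) := by
  classical
  have key : ∀ (P : G.Path y s) (Q : G.Path t z),
      (P.1.append (Walk.cons hst Q.1)).support = P.1.support ++ Q.1.support := by
    intro P Q
    rw [Walk.support_append]; simp
  have hP : ∀ (P : G.Path y s), ∀ a ∈ P.1.support, a ∈ S :=
    fun P => h.stay hy h.1 P.1 P.2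
  have hQ : ∀ (Q : G.Path t z), ∀ a ∈ Q.1.support, a ∉ S :=
    fun Q => h.compl.stay h.2.1 hz Q.1 Q.2
  have hpath : ∀ (P : G.Path y s) (Q : G.Path t z),
      (P.1.append (Walk.cons hst Q.1)).IsPath := by
    intro P Q
    rw [Walk.isPath_def, key, List.nodup_append']
    exact ⟨P.2.support_nodup, Q.2.support_nodup, fun a ha hb => hQ Q a hb (hP P a ha)⟩
  have e : pm G y z = (Finset.univ : Finset (G.Path y s × G.Path t z)).val.map
      (fun a => a.1.1.length + a.2.1.length + 1) := by
    unfold pm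
    symm
    refine map_univ_of_bij
      (fun a : G.Path y s × G.Path t z => (⟨_, hpath a.1 a.2⟩ : G.Path y z)) ⟨?_, ?_⟩ _ _ ?_
    · rintro ⟨P, Q⟩ ⟨P', Q'⟩ he
      have he' := congrArg (fun r : G.Path y z => r.1.support) he
      simp only [key] at he'
      have f1 : ∀ P : G.Path y s, P.1.support.filter (· ∈ S) = P.1.support := fun P =>
        List.filter_eq_self.2 (by simpa using hP P)
      have f2 : ∀ Q : G.Path t z, Q.1.support.filter (· ∈ S) = [] := fun Q =>
        List.filter_eq_nil_iff.2 (by simpa using hQ Q)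
      have he'' := congrArg (List.filter (· ∈ S)) he'
      rw [List.filter_append, List.filter_append, f1, f1, f2, f2, List.append_nil,
        List.append_nil] at he''
      rw [he''] at he'
      have he3 := List.append_cancel_left he'
      exact Prod.ext (Subtype.ext (Walk.ext_support he'')) (Subtype.ext (Walk.ext_support he3))
    · rintro ⟨w, hw⟩
      obtain ⟨_, p₁, p₂, rfl⟩ := h.split hy hz w
      exact ⟨(⟨p₁, hw.of_append_left⟩, ⟨p₂, hw.of_append_right.of_cons⟩), rfl⟩
    · intro a
      simp only [Walk.length_append, Walk.length_cons]
      omega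
  rw [e]
  unfold pm
  rw [← Finset.univ_product_univ, Finset.product_val]
  generalize (Finset.univ : Finset (G.Path y s)).val = A
  generalize (Finset.univ : Finset (G.Path t z)).val = B
  have : ∀ A : Multiset (G.Path y s), (A ×ˢ B).map (fun a => a.1.1.length + a.2.1.length + 1) =
      ((A.map fun p => p.1.length) ×ˢ (B.map fun p => p.1.length)).map
        (fun a => a.1 + a.2 + 1) := by
    intro A
    induction A using Multiset.induction_on with
    | empty => simp
    | cons a A ih =>
      rw [Multiset.cons_product, Multiset.map_add, ih, Multiset.map_cons, Multiset.cons_product,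
        Multiset.map_add, Multiset.map_map, Multiset.map_map, Multiset.map_map]
      rfl
  exact this A

theorem pm_self {V : Type} [Fintype V] {G : SimpleGraph V} (u : V) : pm G u u = {0} := by
  classical
  unfold pm
  have : (Finset.univ : Finset (G.Path u u)) = {Path.nil} := by
    ext P; simp [Path.loop_eq]
  rw [this]
  simp [Path.nil]

theorem mem_pm {V : Type} [Fintype V] {G : SimpleGraph V} (u v : V) (n : ℕ) :
    n ∈ pm G u v ↔ ∃ w : G.Walk u v, w.IsPath ∧ w.length = n := by
  classical
  unfold pm
  simp only [Multiset.mem_map, Finset.mem_val, Finset.mem_univ, true_and]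
  exact ⟨fun ⟨P, h⟩ => ⟨P.1, P.2, h⟩, fun ⟨w, hw, h⟩ => ⟨⟨w, hw⟩, h⟩⟩

theorem lipschitz_walk {V : Type} {G : SimpleGraph V} (f : V → ℤ)
    (hf : ∀ a b, G.Adj a b → f b ≤ f a + 1) {u v : V} (w : G.Walk u v) :
    f v ≤ f u + w.length := by
  induction w with
  | nil => simp
  | cons h q ih =>
    have := hf _ _ h
    rw [Walk.length_cons]; push_cast; linarith

/-! ### Blobs through `p` -/

theorem reach_coe {V : Type} {G : SimpleGraph V} (K : G.Subgraph)
    (hK : ∀ a b, a ∈ K.verts → b ∈ K.verts → G.Adj a b → K.Adj a b)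
    {u v : V} (w : G.Walk u v) (hw : ∀ a ∈ w.support, a ∈ K.verts) :
    ∀ (hu : u ∈ K.verts) (hv : v ∈ K.verts), K.coe.Reachable ⟨u, hu⟩ ⟨v, hv⟩ := by
  induction w with
  | nil => intro hu hv; exact Reachable.refl _
  | @cons a c b h q ih =>
    intro hu hv
    have hc : c ∈ K.verts := hw c (by simp)
    have h1 : K.coe.Adj ⟨a, hu⟩ ⟨c, hc⟩ := hK _ _ hu hc h
    exact h1.reachable.trans (ih (fun d hd => hw d (by simp [hd])) hc hv)

theorem connected_of_center {V : Type} {G : SimpleGraph V} (K : G.Subgraph)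
    (hK : ∀ a b, a ∈ K.verts → b ∈ K.verts → G.Adj a b → K.Adj a b)
    (c : V) (hc : c ∈ K.verts)
    (hr : ∀ a ∈ K.verts, ∃ w : G.Walk a c, ∀ b ∈ w.support, b ∈ K.verts) :
    K.coe.Connected := by
  have hall : ∀ a : K.verts, K.coe.Reachable a ⟨c, hc⟩ := by
    rintro ⟨a, ha⟩
    obtain ⟨w, hw⟩ := hr a ha
    exact reach_coe K hK w hw ha hc
  have : Nonempty K.verts := ⟨⟨c, hc⟩⟩
  exact SimpleGraph.Connected.mk fun a b => (hall a).trans (hall b).symm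

theorem blob_of_walk {X : Type} (N : LabGraph X) {p q r : N.V} (hpq : N.G.Adj p q)
    (hpr : N.G.Adj p r) (hqr : q ≠ r) (w₀ : N.G.Walk q r) (hw₀ : p ∉ w₀.support) :
    ∃ H : N.G.Subgraph, N.IsBlob H ∧ p ∈ H.verts := by
  classical
  obtain ⟨w, hw, hwp⟩ : ∃ w : N.G.Walk q r, w.IsPath ∧ p ∉ w.support :=
    ⟨w₀.bypass, w₀.bypass_isPath, fun h => hw₀ (w₀.support_bypass_subset_support h)⟩
  let T : Set N.V := {a | a = p ∨ a ∈ w.support}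
  let H : N.G.Subgraph := (⊤ : N.G.Subgraph).induce T
  have hHv : H.verts = T := rfl
  have hHa : ∀ a b, a ∈ H.verts → b ∈ H.verts → N.G.Adj a b → H.Adj a b := by
    intro a b ha hb hab
    exact ⟨ha, hb, hab⟩
  have two : N.TwoConnSub H := by
    refine ⟨?_, ?_, ?_⟩
    · have h3 : ({p, q, r} : Set N.V) ⊆ H.verts := by
        rintro a (rfl | rfl | rfl)
        · exact Or.inl rfl
        · exact Or.inr w.start_mem_support
        · exact Or.inr w.end_mem_support
      calc 3 = ({p, q, r} : Set N.V).ncard :=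
            (Set.ncard_eq_three.2 ⟨p, q, r, hpq.ne, hpr.ne, hqr, rfl⟩).symm
        _ ≤ _ := Set.ncard_le_ncard h3 (Set.toFinite _)
    · refine connected_of_center H hHa p (Or.inl rfl) ?_
      rintro a (rfl | ha)
      · exact ⟨Walk.nil, by intro b hb; simp at hb; exact Or.inl hb⟩
      · refine ⟨(w.dropUntil a ha).append (Walk.cons hpr.symm Walk.nil), ?_⟩
        intro b hb
        rw [Walk.mem_support_append_iff] at hb
        rcases hb with hb | hb
        · exact Or.inr (w.support_dropUntil_subset_support ha hb)
        · simp at hb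
          rcases hb with rfl | rfl
          · exact Or.inr w.end_mem_support
          · exact Or.inl rfl
    · intro v hv
      have hK : ∀ a b, a ∈ (H.deleteVerts {v}).verts → b ∈ (H.deleteVerts {v}).verts →
          N.G.Adj a b → (H.deleteVerts {v}).Adj a b := by
        intro a b ha hb hab
        rw [Subgraph.deleteVerts_adj]
        exact ⟨ha.1, ha.2, hb.1, hb.2, hHa a b ha.1 hb.1 hab⟩
      by_cases hvp : v = p
      · subst hvp
        have hin : ∀ b ∈ w.support, b ∈ (H.deleteVerts {v}).verts := by
          intro b hb
          exact ⟨Or.inr hb, fun e => hwp (by rw [Set.mem_singleton_iff] at e; exact e ▸ hb)⟩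
        refine connected_of_center _ hK r (hin r w.end_mem_support) ?_
        rintro a ⟨ha, hav⟩
        rcases ha with ha | ha
        · exact absurd ha hav
        · exact ⟨w.dropUntil a ha, fun b hb => hin b (w.support_dropUntil_subset_support ha hb)⟩
      · have hpin : p ∈ (H.deleteVerts {v}).verts := ⟨Or.inl rfl, fun e => hvp e.symm⟩
        have hin : ∀ b ∈ w.support, b ≠ v → b ∈ (H.deleteVerts {v}).verts :=
          fun b hb hbv => ⟨Or.inr hb, hbv⟩
        refine connected_of_center _ hK p hpin ?_
        rintro a ⟨ha, hav⟩
        rcases ha with rfl | ha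
        · exact ⟨Walk.nil, by intro b hb; simp at hb; exact hb ▸ hpin⟩
        by_cases hd : v ∈ (w.dropUntil a ha).support
        · have ht : v ∉ (w.takeUntil a ha).support := by
            intro ht
            rw [← w.take_spec ha, Walk.isPath_def, Walk.support_append,
              List.nodup_append'] at hw
            refine hw.2.2 ht ?_
            have := (Walk.mem_support_iff _).1 hd
            rcases this with e | e
            · exact absurd e.symm hav
            · exact e
          refine ⟨(w.takeUntil a ha).reverse.append (Walk.cons hpq.symm Walk.nil), ?_⟩
          intro b hb
          rw [Walk.mem_support_append_iff] at hb
          have hx : ∀ b ∈ (w.takeUntil a ha).support, b ∈ (H.deleteVerts {v}).verts :=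
            fun b hb => hin b (w.support_takeUntil_subset_support ha hb) (fun e => ht (e ▸ hb))
          rcases hb with hb | hb
          · exact hx b (by simpa using hb)
          · simp at hb
            rcases hb with rfl | rfl
            · exact hx _ (Walk.start_mem_support _)
            · exact hpin
        · refine ⟨(w.dropUntil a ha).append (Walk.cons hpr.symm Walk.nil), ?_⟩
          intro b hb
          rw [Walk.mem_support_append_iff] at hb
          have hx : ∀ b ∈ (w.dropUntil a ha).support, b ∈ (H.deleteVerts {v}).verts :=
            fun b hb => hin b (w.support_dropUntil_subset_support ha hb) (fun e => hd (e ▸ hb))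
          rcases hb with hb | hb
          · exact hx b hb
          · simp at hb
            rcases hb with rfl | rfl
            · exact hx _ (Walk.end_mem_support _)
            · exact hpin
  obtain ⟨B, hHB, hB⟩ := Finite.exists_le_maximal (p := fun K => N.TwoConnSub K) two
  refine ⟨B, ⟨hB.1, fun H' h1 h2 => le_antisymm (hB.2 h1 h2) h2⟩, hHB.1 (Or.inl rfl)⟩

/-! ### The structure of the network around `p` -/

/-- Deleting `p` splits the graph into the leaf `l` and two sides `Q`, `R`. -/
structure Setup {V : Type} (G : SimpleGraph V) (l p q r : V) (Q R : Set V) : Prop where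
  padj : ∀ v, G.Adj p v ↔ v = l ∨ v = q ∨ v = r
  ladj : ∀ v, G.Adj l v ↔ v = p
  hq : q ∈ Q
  hr : r ∈ R
  disj : ∀ a, a ∈ Q → a ∉ R
  pQ : p ∉ Q
  pR : p ∉ R
  lQ : l ∉ Q
  lR : l ∉ R
  cover : ∀ a, a = l ∨ a = p ∨ a ∈ Q ∨ a ∈ R
  exQ : ∀ a b, a ∈ Q → b ∉ Q → G.Adj a b → a = q ∧ b = p
  exR : ∀ a b, a ∈ R → b ∉ R → G.Adj a b → a = r ∧ b = p

theorem Setup.swap {V : Type} {G : SimpleGraph V} {l p q r : V} {Q R : Set V}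
    (h : Setup G l p q r Q R) : Setup G l p r q R Q where
  padj v := by rw [h.padj]; tauto
  ladj := h.ladj
  hq := h.hr
  hr := h.hq
  disj a ha hb := h.disj a hb ha
  pQ := h.pR
  pR := h.pQ
  lQ := h.lR
  lR := h.lQ
  cover a := by have := h.cover a; tauto
  exQ := h.exR
  exR := h.exQ

theorem Setup.exists_of {X : Type} [Fintype X] [DecidableEq X] (hX : 3 ≤ Fintype.card X)
    (N : LabGraph X) (hN : N.IsNetwork)
    (x : X) (hx : ¬ ∃ H : N.G.Subgraph, N.IsBlob H ∧ N.LeafInBlob x H)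
    (p : N.V) (hp : N.G.Adj (N.leaf x) p)
    (hmem : ∀ a : X, a ≠ x → N.leaf a ≠ N.leaf x ∧ N.leaf a ≠ p) :
    ∃ q r Q R, Setup N.G (N.leaf x) p q r Q R := by
  classical
  obtain ⟨hc, hinj, h⟩ := hN
  have hdeg : (∀ x : X, N.degOf (N.leaf x) = 1) ∧
        ∀ v : N.V, v ∉ Set.range N.leaf → N.degOf v = 3 := by
    rcases h with h | h
    · have := Fintype.card_le_of_injective _ hinj
      omega
    · exact h
  have hl : ∀ v, N.G.Adj (N.leaf x) v ↔ v = p := by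
    have h1 := hdeg.1 x
    unfold degOf at h1
    obtain ⟨a, ha⟩ := Set.ncard_eq_one.1 h1
    have hpa : p ∈ N.G.neighborSet (N.leaf x) := hp
    rw [ha, Set.mem_singleton_iff] at hpa
    intro v
    rw [← SimpleGraph.mem_neighborSet, ha, hpa, Set.mem_singleton_iff]
  have hpr : p ∉ Set.range N.leaf := by
    rintro ⟨a, ha⟩
    by_cases hax : a = x
    · subst hax; rw [ha] at hp; exact hp.ne rfl
    · exact (hmem a hax).2 ha
  have h3 := hdeg.2 p hpr
  obtain ⟨q, r, hqr, hlq, hlr, hpn⟩ : ∃ q r, q ≠ r ∧ N.leaf x ≠ q ∧ N.leaf x ≠ r ∧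
      ∀ v, N.G.Adj p v ↔ v = N.leaf x ∨ v = q ∨ v = r := by
    unfold degOf at h3
    obtain ⟨a, b, c, hab, hac, hbc, he⟩ := Set.ncard_eq_three.1 h3
    have hlm : N.leaf x ∈ N.G.neighborSet p := hp.symm
    have hA : ∀ v, N.G.Adj p v ↔ v = a ∨ v = b ∨ v = c := by
      intro v
      rw [← SimpleGraph.mem_neighborSet, he]; rfl
    rw [he] at hlm
    rcases hlm with e | e | e
    · exact ⟨b, c, hbc, e ▸ hab, e ▸ hac, fun v => by rw [hA, e]⟩
    · exact ⟨a, c, hac, e ▸ hab.symm, e ▸ hbc, fun v => by rw [hA, e]; tauto⟩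
    · rw [Set.mem_singleton_iff] at e
      exact ⟨a, b, hab, e ▸ hac.symm, e ▸ hbc.symm, fun v => by rw [hA, e]; tauto⟩
  have hpq : N.G.Adj p q := (hpn q).2 (by tauto)
  have hpr' : N.G.Adj p r := (hpn r).2 (by tauto)
  let Q : Set N.V := {v | ∃ w : N.G.Walk q v, p ∉ w.support}
  have hqQ : q ∈ Q := ⟨Walk.nil, by simpa using hpq.ne⟩
  have hpQ : p ∉ Q := fun ⟨w, hw⟩ => hw w.end_mem_support
  have hstep : ∀ a b, a ∈ Q → b ∉ Q → N.G.Adj a b → b = p := by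
    rintro a b ⟨w, hw⟩ hb hab
    by_contra hbp
    apply hb
    refine ⟨w.append (Walk.cons hab Walk.nil), ?_⟩
    rw [Walk.mem_support_append_iff]
    rintro (h | h)
    · exact hw h
    · simp at h
      rcases h with h | h
      · exact hw (h ▸ w.end_mem_support)
      · exact hbp h.symm
  have hlQ : N.leaf x ∉ Q := by
    rintro ⟨w, hw⟩
    have hw' : p ∉ w.reverse.support := by simpa using hw
    generalize w.reverse = w' at hw'
    cases w' with
    | nil => exact hlq rfl
    | cons h t =>
      obtain rfl := (hl _).1 h
      exact hw' (by simp)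
  have hrQ : r ∉ Q := by
    rintro ⟨w, hw⟩
    obtain ⟨H, hH, hpH⟩ := blob_of_walk N hpq hpr' hqr w hw
    exact hx ⟨H, hH, p, hp, hpH⟩
  have hexQ : ∀ a b, a ∈ Q → b ∉ Q → N.G.Adj a b → a = q ∧ b = p := by
    intro a b ha hb hab
    obtain rfl := hstep a b ha hb hab
    refine ⟨?_, rfl⟩
    rcases (hpn a).1 hab.symm with rfl | rfl | rfl
    · exact absurd ha hlQ
    · rfl
    · exact absurd ha hrQ
  refine ⟨q, r, Q, {v | v ∉ Q ∧ v ≠ p ∧ v ≠ N.leaf x}, hpn, hl, hqQ, ⟨hrQ, hpr'.ne', hlr.symm⟩,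
    fun a ha h => h.1 ha, hpQ, fun h => h.2.1 rfl, hlQ, fun h => h.2.2 rfl, ?_, hexQ, ?_⟩
  · intro a
    simp only [Set.mem_ofPred_eq]
    tauto
  · rintro a b ⟨ha1, ha2, ha3⟩ hb hab
    by_cases hbQ : b ∈ Q
    · exact absurd (hexQ b a hbQ ha1 hab.symm).2 ha2
    by_cases hbl : b = N.leaf x
    · subst hbl
      exact absurd ((hl a).1 hab.symm) ha2
    have hbp : b = p := by
      by_contra hbp
      exact hb ⟨hbQ, hbp, hbl⟩
    subst hbp
    refine ⟨?_, rfl⟩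
    rcases (hpn a).1 hab.symm with e | e | e
    · exact absurd e ha3
    · exact absurd (e ▸ hqQ) ha1
    · exact e

section
variable {V : Type} {G : SimpleGraph V} {l p q r : V} {Q R : Set V}

theorem Setup.seQ (h : Setup G l p q r Q R) : SE G Q q p := ⟨h.hq, h.pQ, h.exQ⟩

theorem Setup.seR (h : Setup G l p q r Q R) : SE G R r p := ⟨h.hr, h.pR, h.exR⟩

theorem Setup.seL (h : Setup G l p q r Q R) : SE G {l} l p := by
  have hp : G.Adj p l := (h.padj l).2 (Or.inl rfl)
  refine ⟨rfl, hp.ne, ?_⟩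
  rintro a b rfl _ hab
  exact ⟨rfl, (h.ladj b).1 hab⟩

theorem Setup.same_side_ne (h : Setup G l p q r Q R) (hG : G.Connected) {a b : V}
    (ha : a ∈ Q) (hb : b ∈ Q) : G.dist a b + 2 ≠ G.dist l a + G.dist l b := by
  have key : ∀ a ∈ Q, G.dist q a + 2 ≤ G.dist l a := by
    intro a ha
    have h1 := h.seL.dist_ge hG (v := a) rfl (fun e => h.lQ (by
      rw [Set.mem_singleton_iff] at e; exact e ▸ ha))
    have h2 := h.seQ.dist_ge hG ha h.pQ
    rw [SimpleGraph.dist_comm (u := a) (v := q), SimpleGraph.dist_comm (u := a) (v := p)] at h2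
    omega
  have h1 := key a ha
  have h2 := key b hb
  have h3 : G.dist a b ≤ G.dist a q + G.dist q b := hG.dist_triangle
  rw [SimpleGraph.dist_comm (u := a) (v := q)] at h3
  omega

theorem Setup.ne_of_Q (h : Setup G l p q r Q R) {a : V} (ha : a ∈ Q) : a ≠ l ∧ a ≠ p :=
  ⟨fun e => h.lQ (e ▸ ha), fun e => h.pQ (e ▸ ha)⟩

theorem Setup.mem_or (h : Setup G l p q r Q R) {a : V} (ha : a ≠ l ∧ a ≠ p) : a ∈ Q ∨ a ∈ R := by
  have := h.cover a
  tauto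

variable {G' : SimpleGraph {v : V // v ≠ l ∧ v ≠ p}}

theorem Setup.adj' (h : Setup G l p q r Q R)
    (hG' : ∀ a b, G'.Adj a b ↔ a ≠ b ∧ (G.Adj a.1 b.1 ∨ (G.Adj a.1 p ∧ G.Adj b.1 p))) (a b) :
    G'.Adj a b ↔ G.Adj a.1 b.1 ∨ (a.1 = q ∧ b.1 = r) ∨ (a.1 = r ∧ b.1 = q) := by
  have hqr : q ≠ r := fun e => h.disj q h.hq (e ▸ h.hr)
  rw [hG', G.adj_comm a.1 p, G.adj_comm b.1 p, h.padj, h.padj]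
  have ha := a.2.1
  have hb := b.2.1
  constructor
  · rintro ⟨hab, h1 | ⟨h1, h2⟩⟩
    · exact Or.inl h1
    · have hab' : a.1 ≠ b.1 := fun e => hab (Subtype.ext e)
      rcases h1 with h1 | h1 | h1
      · exact absurd h1 ha
      · rcases h2 with h2 | h2 | h2
        · exact absurd h2 hb
        · exact absurd (h1.trans h2.symm) hab'
        · exact Or.inr (Or.inl ⟨h1, h2⟩)
      · rcases h2 with h2 | h2 | h2
        · exact absurd h2 hb
        · exact Or.inr (Or.inr ⟨h1, h2⟩)
        · exact absurd (h1.trans h2.symm) hab'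
  · rintro (h1 | ⟨h1, h2⟩ | ⟨h1, h2⟩)
    · exact ⟨fun e => h1.ne (congrArg Subtype.val e), Or.inl h1⟩
    · refine ⟨fun e => hqr ?_, Or.inr ⟨by tauto, by tauto⟩⟩
      rw [← h1, ← h2, e]
    · refine ⟨fun e => hqr ?_, Or.inr ⟨by tauto, by tauto⟩⟩
      rw [← h1, ← h2, e]

theorem Setup.seQ' (h : Setup G l p q r Q R)
    (hG' : ∀ a b, G'.Adj a b ↔ a ≠ b ∧ (G.Adj a.1 b.1 ∨ (G.Adj a.1 p ∧ G.Adj b.1 p))) :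
    SE G' {a | a.1 ∈ Q} ⟨q, h.ne_of_Q h.hq⟩ ⟨r, h.swap.ne_of_Q h.hr⟩ := by
  refine ⟨h.hq, fun hr => h.disj _ hr h.hr, ?_⟩
  intro a b ha hb hab
  rw [h.adj' hG'] at hab
  rcases hab with h1 | ⟨h1, h2⟩ | ⟨h1, h2⟩
  · exact absurd (h.exQ _ _ ha hb h1).2 b.2.2
  · exact ⟨Subtype.ext h1, Subtype.ext h2⟩
  · exact absurd (show b.1 ∈ Q from h2 ▸ h.hq) hb

theorem Setup.pm_same [Fintype V] [Fintype {v : V // v ≠ l ∧ v ≠ p}]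
    (h : Setup G l p q r Q R)
    (hG' : ∀ a b, G'.Adj a b ↔ a ≠ b ∧ (G.Adj a.1 b.1 ∨ (G.Adj a.1 p ∧ G.Adj b.1 p)))
    (a b : {v : V // v ≠ l ∧ v ≠ p}) (ha : a.1 ∈ Q) (hb : b.1 ∈ Q) :
    pm G' a b = pm G a.1 b.1 := by
  classical
  let φ : G.induce Q ↪g G := SimpleGraph.Embedding.induce Q
  let ψ : G.induce Q ↪g G' :=
    { toFun := fun v => ⟨v.1, h.ne_of_Q v.2⟩
      inj' := fun v w e => Subtype.ext (congrArg (fun t : {v : V // v ≠ l ∧ v ≠ p} => t.1) e)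
      map_rel_iff' := by
        intro v w
        change G'.Adj ⟨v.1, _⟩ ⟨w.1, _⟩ ↔ G.Adj v.1 w.1
        rw [h.adj' hG']
        constructor
        · rintro (h1 | ⟨h1, h2⟩ | ⟨h1, h2⟩)
          · exact h1
          · exact absurd h.hr (h.disj r (h2 ▸ w.2))
          · exact absurd h.hr (h.disj r (h1 ▸ v.2))
        · exact Or.inl }
  have e1 := pm_embed φ ⟨a.1, ha⟩ ⟨b.1, hb⟩ (fun w hw c hc =>
    ⟨⟨c, h.seQ.stay ha hb w hw c hc⟩, rfl⟩)
  have e2 := pm_embed ψ ⟨a.1, ha⟩ ⟨b.1, hb⟩ (fun w hw c hc =>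
    ⟨⟨c.1, (h.seQ' hG').stay ha hb w hw c hc⟩, rfl⟩)
  exact e2.symm.trans e1

theorem Setup.pm_cross [Fintype V] [Fintype {v : V // v ≠ l ∧ v ≠ p}]
    (h : Setup G l p q r Q R)
    (hG' : ∀ a b, G'.Adj a b ↔ a ≠ b ∧ (G.Adj a.1 b.1 ∨ (G.Adj a.1 p ∧ G.Adj b.1 p)))
    (a b : {v : V // v ≠ l ∧ v ≠ p}) (ha : a.1 ∈ Q) (hb : b.1 ∈ R) :
    pm G a.1 b.1 = (pm G' a b).map (· + 1) := by
  have hbQ : b.1 ∉ Q := fun e => h.disj _ e hb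
  have hqp : G.Adj q p := ((h.padj q).2 (by tauto)).symm
  have hpr : G.Adj p r := (h.padj r).2 (by tauto)
  rw [LabGraph.pm_cross h.seQ hqp ha hbQ,
    LabGraph.pm_cross h.seR.compl hpr (y := p) (z := b.1) h.pR (fun e => e hb), pm_self,
    LabGraph.pm_cross (h.seQ' hG') ((h.adj' hG' _ _).2 (by tauto)) (y := a) (z := b) ha hbQ,
    h.pm_same hG' a _ ha h.hq, h.swap.pm_same hG' _ b h.hr hb]
  generalize pm G a.1 q = A
  generalize pm G r b.1 = B
  rw [Multiset.map_map]
  have e : (({0} : Multiset ℕ) ×ˢ B).map (fun a => a.1 + a.2 + 1) = B.map (· + 1) := by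
    rw [← Multiset.cons_zero, Multiset.cons_product]
    simp
  change (A ×ˢ (({0} : Multiset ℕ) ×ˢ B).map (fun a => a.1 + a.2 + 1)).map _ = _
  rw [e]
  induction A using Multiset.induction_on with
  | empty => simp
  | cons a A ih =>
    rw [Multiset.cons_product, Multiset.map_add, ih, Multiset.cons_product,
        Multiset.map_add, Multiset.map_map, Multiset.map_map, Multiset.map_map]
    congr 1

end

/-! ### Reattaching -/

section
variable {x : X} {M : LabGraph {a : X // a ≠ x}} {u v : M.V}

theorem re_ll (a b : M.V) : (reattach x M u v).G.Adj (Sum.inl a) (Sum.inl b) ↔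
    M.G.Adj a b ∧ ¬(a = u ∧ b = v) ∧ ¬(a = v ∧ b = u) := by
  simp only [reattach, SimpleGraph.fromRel_adj]
  constructor
  · rintro ⟨_, (⟨c, d, h1, h2, h3⟩ | ⟨_, _, h, _⟩ | ⟨h, _⟩) |
      (⟨c, d, h1, h2, h3⟩ | ⟨_, _, h, _⟩ | ⟨h, _⟩)⟩
    · cases h1; cases h2; exact h3
    · cases h
    · cases h
    · cases h1; cases h2; exact ⟨h3.1.symm, by tauto, by tauto⟩
    · cases h
    · cases h
  · intro h
    exact ⟨fun e => h.1.ne (Sum.inl.inj e), Or.inl (Or.inl ⟨a, b, rfl, rfl, h⟩)⟩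

theorem re_l0 (a : M.V) : (reattach x M u v).G.Adj (Sum.inl a) (Sum.inr 0) ↔ a = u ∨ a = v := by
  simp [reattach, SimpleGraph.fromRel_adj]

theorem re_l1 (a : M.V) : ¬ (reattach x M u v).G.Adj (Sum.inl a) (Sum.inr 1) := by
  simp [reattach, SimpleGraph.fromRel_adj]

theorem re_01 : (reattach x M u v).G.Adj (Sum.inr 0) (Sum.inr 1) := by
  simp [reattach, SimpleGraph.fromRel_adj]

theorem re_lipschitz (g : M.V → ℤ) (hg : ∀ a b, M.G.Adj a b → g b ≤ g a + 1)
    (huv : M.G.Adj u v) (y : {a : X // a ≠ x})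
    (w : (reattach x M u v).G.Walk ((reattach x M u v).leaf x) ((reattach x M u v).leaf y.1)) :
    min (g u) (g v) + 2 ≤ g (M.leaf y) + w.length := by
  let f : M.V ⊕ Fin 2 → ℤ :=
    Sum.elim g (fun i => if i = 0 then min (g u) (g v) + 1 else min (g u) (g v) + 2)
  have h1 := hg _ _ huv
  have h2 := hg _ _ huv.symm
  have key : ∀ a b, (reattach x M u v).G.Adj a b → f b ≤ f a + 1 := by
    have f0 : f (Sum.inr 0) = min (g u) (g v) + 1 := by simp [f]
    have f1 : f (Sum.inr 1) = min (g u) (g v) + 2 := by simp [f]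
    have fl : ∀ a, f (Sum.inl a) = g a := fun a => by simp [f]
    have c0 : ∀ a, (reattach x M u v).G.Adj (Sum.inl a) (Sum.inr 0) →
        f (Sum.inr 0) ≤ f (Sum.inl a) + 1 ∧ f (Sum.inl a) ≤ f (Sum.inr 0) + 1 := by
      intro a h
      rw [f0, fl]
      rcases (re_l0 a).1 h with rfl | rfl <;> constructor <;> omega
    rintro (a | i) (b | j) hab
    · exact hg _ _ ((re_ll a b).1 hab).1
    · fin_cases j
      · exact (c0 a hab).1
      · exact absurd hab (re_l1 a)
    · fin_cases i
      · exact (c0 b hab.symm).2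
      · exact absurd hab.symm (re_l1 b)
    · fin_cases i <;> fin_cases j
      · exact absurd hab (SimpleGraph.irrefl _)
      · change f (Sum.inr 1) ≤ f (Sum.inr 0) + 1
        rw [f0, f1]; omega
      · change f (Sum.inr 0) ≤ f (Sum.inr 1) + 1
        rw [f0, f1]; omega
      · exact absurd hab (SimpleGraph.irrefl _)
  have hrev : ((Walk.reverse w).length : ℤ) = w.length := by rw [Walk.length_reverse]
  have := lipschitz_walk f key w.reverse
  have ex : (reattach x M u v).leaf x = Sum.inr 1 := by simp [reattach]
  have ey : (reattach x M u v).leaf y.1 = Sum.inl (M.leaf y) := by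
    simp [reattach, y.2]
  have e1 : f ((reattach x M u v).leaf x) = min (g u) (g v) + 2 := by rw [ex]; simp [f]
  have e2 : f ((reattach x M u v).leaf y.1) = g (M.leaf y) := by rw [ey]; simp [f]
  have h3 : min (g u) (g v) + 2 ≤ g (M.leaf y) + ((Walk.reverse w).length : ℤ) := by
    rw [← e1, ← e2]; exact this
  rw [hrev] at h3
  exact h3

end

theorem leafDelete_adj (N : LabGraph X) (x : X) (p : N.V)
    (hmem : ∀ a : X, a ≠ x → N.leaf a ≠ N.leaf x ∧ N.leaf a ≠ p)
    (a b : {v : N.V // v ≠ N.leaf x ∧ v ≠ p}) :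
    (N.leafDelete x p hmem).G.Adj a b ↔
      a ≠ b ∧ (N.G.Adj a.1 b.1 ∨ (N.G.Adj a.1 p ∧ N.G.Adj b.1 p)) := by
  simp only [leafDelete, SimpleGraph.fromRel_adj]
  rw [N.G.adj_comm b.1 a.1]
  tauto

theorem dms_eq_pm (N : LabGraph X) (a b : X) : N.dms a b = pm N.G (N.leaf a) (N.leaf b) := rfl

theorem dms_of_isom {N M : LabGraph X} (h : N.IsomLabelled M) (a b : X) :
    N.dms a b = M.dms a b := by
  obtain ⟨φ, hφ⟩ := h
  rw [dms_eq_pm, dms_eq_pm, ← hφ a, ← hφ b]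
  exact pm_embed φ.toEmbedding _ _ (fun w _ c _ => φ.surjective c)

theorem isom_reattach (N : LabGraph X) (x : X) (p : N.V)
    (hmem : ∀ a : X, a ≠ x → N.leaf a ≠ N.leaf x ∧ N.leaf a ≠ p)
    {q r : N.V} {Q R : Set N.V} (h : Setup N.G (N.leaf x) p q r Q R) :
    (reattach x (N.leafDelete x p hmem) ⟨q, h.ne_of_Q h.hq⟩
      ⟨r, h.swap.ne_of_Q h.hr⟩).IsomLabelled N := by
  have hpl : N.G.Adj p (N.leaf x) := (h.padj _).2 (Or.inl rfl)
  have hnqr : ¬ N.G.Adj q r := fun e => h.pR ((h.exQ q r h.hq (fun e => h.disj _ e h.hr) e).2 ▸ h.hr)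
  let f : {v : N.V // v ≠ N.leaf x ∧ v ≠ p} ⊕ Fin 2 → N.V :=
    Sum.elim (fun a => a.1) (fun i => if i = 0 then p else N.leaf x)
  have f0 : f (Sum.inr 0) = p := by simp [f]
  have f1 : f (Sum.inr 1) = N.leaf x := by simp [f]
  have fl : ∀ a, f (Sum.inl a) = a.1 := fun a => by simp [f]
  have hf : Function.Bijective f := by
    constructor
    · rintro (a | i) (b | j) hab
      · rw [fl, fl] at hab; rw [Subtype.ext hab]
      · exfalso
        fin_cases j
        · exact a.2.2 hab
        · exact a.2.1 hab
      · exfalso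
        fin_cases i
        · exact b.2.2 hab.symm
        · exact b.2.1 hab.symm
      · fin_cases i <;> fin_cases j
        · rfl
        · exact absurd hab hpl.ne
        · exact absurd hab hpl.ne'
        · rfl
    · intro v
      by_cases h1 : v = N.leaf x
      · exact ⟨Sum.inr 1, by rw [f1, h1]⟩
      by_cases h2 : v = p
      · exact ⟨Sum.inr 0, by rw [f0, h2]⟩
      exact ⟨Sum.inl ⟨v, h1, h2⟩, rfl⟩
  let H := reattach x (N.leafDelete x p hmem) ⟨q, h.ne_of_Q h.hq⟩ ⟨r, h.swap.ne_of_Q h.hr⟩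
  have hl0 : ∀ a : {v : N.V // v ≠ N.leaf x ∧ v ≠ p}, N.G.Adj a.1 p ↔
      H.G.Adj (Sum.inl a) (Sum.inr 0) := by
    intro a
    refine Iff.trans ?_ (re_l0 (M := N.leafDelete x p hmem) a).symm
    rw [N.G.adj_comm, h.padj]
    have := a.2.1
    constructor
    · rintro (e | e | e)
      · exact absurd e this
      · exact Or.inl (Subtype.ext e)
      · exact Or.inr (Subtype.ext e)
    · rintro (e | e)
      · exact Or.inr (Or.inl (congrArg Subtype.val e))
      · exact Or.inr (Or.inr (congrArg Subtype.val e))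
  have hl1 : ∀ a : {v : N.V // v ≠ N.leaf x ∧ v ≠ p}, N.G.Adj a.1 (N.leaf x) ↔
      H.G.Adj (Sum.inl a) (Sum.inr 1) := by
    intro a
    refine iff_of_false (fun e => ?_) (re_l1 (M := N.leafDelete x p hmem) a)
    exact a.2.2 ((h.ladj _).1 e.symm)
  have h01 : H.G.Adj (Sum.inr 0) (Sum.inr 1) := re_01
  refine ⟨⟨Equiv.ofBijective f hf, ?_⟩, ?_⟩
  · intro a b
    change N.G.Adj (f a) (f b) ↔ H.G.Adj a b
    rcases a with a | i <;> rcases b with b | j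
    · refine Iff.trans ?_ (re_ll (M := N.leafDelete x p hmem) a b).symm
      refine Iff.trans ?_ (and_congr_left' (h.adj' (leafDelete_adj N x p hmem) a b)).symm
      change N.G.Adj a.1 b.1 ↔ _
      constructor
      · intro e
        refine ⟨Or.inl e, ?_, ?_⟩
        · rintro ⟨rfl, rfl⟩; exact hnqr e
        · rintro ⟨rfl, rfl⟩; exact hnqr e.symm
      · rintro ⟨e | ⟨e1, e2⟩ | ⟨e1, e2⟩, h1, h2⟩
        · exact e
        · exact absurd ⟨Subtype.ext e1, Subtype.ext e2⟩ h1
        · exact absurd ⟨Subtype.ext e1, Subtype.ext e2⟩ h2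
    · fin_cases j
      · exact hl0 a
      · exact hl1 a
    · refine (N.G.adj_comm _ _).trans (Iff.trans ?_ (H.G.adj_comm _ _))
      fin_cases i
      · exact hl0 b
      · exact hl1 b
    · fin_cases i <;> fin_cases j
      · exact iff_of_false (SimpleGraph.irrefl _) (SimpleGraph.irrefl _)
      · exact iff_of_true hpl h01
      · exact iff_of_true hpl.symm h01.symm
      · exact iff_of_false (SimpleGraph.irrefl _) (SimpleGraph.irrefl _)
  · intro a
    change f _ = _
    by_cases hax : a = x
    · have e : H.leaf a = Sum.inr 1 := by simp [H, reattach, hax]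
      rw [hax] at e ⊢
      exact (congrArg f e).trans f1
    · have e : H.leaf a = Sum.inl ((N.leafDelete x p hmem).leaf ⟨a, hax⟩) := by
        simp [H, reattach, hax]
      exact congrArg f e

theorem no_reattach_R (N : LabGraph X) (hN : N.G.Connected) (x : X) (p : N.V)
    (hmem : ∀ a : X, a ≠ x → N.leaf a ≠ N.leaf x ∧ N.leaf a ≠ p)
    {q r : N.V} {Q R : Set N.V} (h : Setup N.G (N.leaf x) p q r Q R)
    (u v : {v : N.V // v ≠ N.leaf x ∧ v ≠ p}) (huv : (N.leafDelete x p hmem).G.Adj u v)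
    (hu : u.1 ∈ R) (hv : v.1 ∈ R) (y : X) (hyx : y ≠ x) (hy : N.leaf y ∈ Q)
    (hd : (reattach x (N.leafDelete x p hmem) u v).dms x y = N.dms x y) : False := by
  classical
  have hpl : N.G.Adj p (N.leaf x) := (h.padj _).2 (Or.inl rfl)
  have hpq : N.G.Adj p q := (h.padj _).2 (by tauto)
  have hpr : N.G.Adj p r := (h.padj _).2 (by tauto)
  obtain ⟨w, hw, hwl⟩ := hN.exists_path_of_dist (N.leaf x) (N.leaf y)
  have hmemd : w.length ∈ (reattach x (N.leafDelete x p hmem) u v).dms x y := by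
    rw [hd, dms_eq_pm, mem_pm]
    exact ⟨w, hw, rfl⟩
  rw [dms_eq_pm, mem_pm] at hmemd
  obtain ⟨w', -, hw'⟩ := hmemd
  let D : N.V → ℕ := fun a => N.G.dist (N.leaf y) a
  have hD : ∀ a b, N.G.Adj a b → (D b : ℤ) ≤ D a + 1 := by
    intro a b hab
    have h1 : D b ≤ D a + N.G.dist a b := hN.dist_triangle
    rw [SimpleGraph.dist_eq_one_iff_adj.2 hab] at h1
    exact_mod_cast h1
  have hDR : ∀ a ∈ R, D p + 1 ≤ D a := by
    intro a ha
    have h1 := h.seR.compl.dist_ge hN (u := N.leaf y) (v := a) (h.disj _ hy) (fun e => e ha)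
    change D p + 1 + _ ≤ D a at h1
    omega
  have hDq : D q + 1 ≤ D p := by
    have h1 := h.seQ.dist_ge hN (u := N.leaf y) (v := p) hy h.pQ
    change D q + 1 + _ ≤ D p at h1
    omega
  let g : {v : N.V // v ≠ N.leaf x ∧ v ≠ p} → ℤ := fun a => D a.1 - if a.1 ∈ R then 1 else 0
  have gQ : ∀ a, a.1 ∈ Q → g a = D a.1 := by
    intro a ha; simp [g, h.disj _ ha]
  have gR : ∀ a, a.1 ∈ R → g a = D a.1 - 1 := by
    intro a ha; simp [g, ha]
  have hg : ∀ a b, (N.leafDelete x p hmem).G.Adj a b → g b ≤ g a + 1 := by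
    intro a b hab
    have h1 := hD _ _ hpq
    have h2 := hD _ _ hpr
    have h3 := hD _ _ hpq.symm
    have h5 := hDR r h.hr
    rcases (h.adj' (leafDelete_adj N x p hmem) a b).1 hab with e | ⟨e1, e2⟩ | ⟨e1, e2⟩
    · have h4 := hD _ _ e
      rcases h.mem_or a.2 with ha | ha
      · by_cases hb : b.1 ∈ Q
        · rw [gQ a ha, gQ b hb]; exact h4
        · exact absurd (h.exQ _ _ ha hb e).2 b.2.2
      · by_cases hb : b.1 ∈ R
        · rw [gR a ha, gR b hb]; omega
        · exact absurd (h.exR _ _ ha hb e).2 b.2.2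
    · rw [gQ a (e1 ▸ h.hq), gR b (e2 ▸ h.hr), e1, e2]; omega
    · rw [gR a (e1 ▸ h.hr), gQ b (e2 ▸ h.hq), e1, e2]; omega
  have key := re_lipschitz (x := x) (M := N.leafDelete x p hmem) (u := u) (v := v) g hg huv
    ⟨y, hyx⟩ w'
  have hy0 : g ((N.leafDelete x p hmem).leaf ⟨y, hyx⟩) = 0 := by
    refine (gQ ⟨N.leaf y, hmem y hyx⟩ hy).trans ?_
    change ((N.G.dist (N.leaf y) (N.leaf y) : ℕ) : ℤ) = 0
    simp
  have hxy : (w.length : ℤ) ≤ D p + 1 := by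
    rw [hwl, SimpleGraph.dist_comm]
    exact hD _ _ hpl
  have h1 := hDR _ hu
  have h2 := hDR _ hv
  rw [hy0, hw', gR u hu, gR v hv] at key
  omega

theorem toZ_eq (A : Multiset ℕ) : toZ A = A.map (fun t : ℕ => (t : ℤ)) := by
  unfold toZ
  simp [Multiset.bind_def, Multiset.pure_def, Multiset.bind_singleton]

theorem zsub_eq (A : Multiset ℕ) (n : ℤ) : zsub A n = A.map (fun t : ℕ => (t : ℤ) - n) := by
  unfold zsub
  simp [Multiset.bind_def, Multiset.pure_def, Multiset.bind_singleton]

theorem main_aux (N : LabGraph X) (hN : N.G.Connected) (x : X) (p : N.V)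
    (hmem : ∀ a : X, a ≠ x → N.leaf a ≠ N.leaf x ∧ N.leaf a ≠ p)
    {q r : N.V} {Q R : Set N.V} (h : Setup N.G (N.leaf x) p q r Q R)
    (Y Z : Set X) (hYZ : GoodPartition N x Y Z)
    (hY : ∀ y ∈ Y, N.leaf y ∈ Q) (hZ : ∀ z ∈ Z, N.leaf z ∈ R) :
    ∀ N' : LabGraph {a : X // a ≠ x}, N' = N.leafDelete x p hmem →
      ((∀ (y z : X) (hy : y ≠ x) (hz : z ≠ x),
          ((y ∈ Y ∧ z ∈ Y) ∨ (y ∈ Z ∧ z ∈ Z)) →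
          N'.dms ⟨y, hy⟩ ⟨z, hz⟩ = N.dms y z) ∧
       (∀ (y z : X) (hy : y ≠ x) (hz : z ≠ x),
          ((y ∈ Y ∧ z ∈ Z) ∨ (y ∈ Z ∧ z ∈ Y)) →
          toZ (N'.dms ⟨y, hy⟩ ⟨z, hz⟩) = zsub (N.dms y z) 1) ∧
       (∃ u v : N'.V, N'.G.Adj u v ∧
          (∀ a b : X, (reattach x N' u v).dms a b = N.dms a b) ∧
          (reattach x N' u v).IsomLabelled N ∧
          ∀ u' v' : N'.V, N'.G.Adj u' v' →
            (∀ a b : X, (reattach x N' u' v').dms a b = N.dms a b) →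
            s(u', v') = s(u, v))) := by
  rintro _ rfl
  have hG' := leafDelete_adj N x p hmem
  let inst : Fintype {v : N.V // v ≠ N.leaf x ∧ v ≠ p} := (N.leafDelete x p hmem).fV
  refine ⟨?_, ?_, ?_⟩
  · rintro y z hy hz (⟨h1, h2⟩ | ⟨h1, h2⟩)
    · exact h.pm_same hG' _ _ (hY y h1) (hY z h2)
    · exact h.swap.pm_same hG' _ _ (hZ y h1) (hZ z h2)
  · intro y z hy hz hyz
    have e : N.dms y z = ((N.leafDelete x p hmem).dms ⟨y, hy⟩ ⟨z, hz⟩).map (· + 1) := by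
      rcases hyz with ⟨h1, h2⟩ | ⟨h1, h2⟩
      · exact h.pm_cross hG' ⟨N.leaf y, hmem y hy⟩ ⟨N.leaf z, hmem z hz⟩ (hY y h1) (hZ z h2)
      · exact h.swap.pm_cross hG' ⟨N.leaf y, hmem y hy⟩ ⟨N.leaf z, hmem z hz⟩ (hZ y h1) (hY z h2)
    rw [e, zsub_eq, toZ_eq, Multiset.map_map]
    exact Multiset.map_congr rfl fun a _ => by simp
  · have hiso := isom_reattach N x p hmem h
    refine ⟨⟨q, h.ne_of_Q h.hq⟩, ⟨r, h.swap.ne_of_Q h.hr⟩, ?_, dms_of_isom hiso, hiso, ?_⟩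
    · exact (h.adj' hG' _ _).2 (by tauto)
    · intro u v huv hd
      obtain ⟨hU, -, hYn, hZn, -⟩ := hYZ
      obtain ⟨y, hy⟩ := Set.nonempty_iff_ne_empty.2 hYn
      obtain ⟨z, hz⟩ := Set.nonempty_iff_ne_empty.2 hZn
      have hyx : y ≠ x := by
        have : y ∈ Y ∪ Z := Or.inl hy
        rw [hU] at this; exact this
      have hzx : z ≠ x := by
        have : z ∈ Y ∪ Z := Or.inr hz
        rw [hU] at this; exact this
      by_cases hu : u.1 ∈ Q <;> by_cases hv : v.1 ∈ Q
      · exact (no_reattach_R N hN x p hmem h.swap u v huv hu hv z hzx (hZ z hz) (hd x z)).elim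
      · obtain ⟨e1, e2⟩ := (h.seQ' hG').2.2 u v hu hv huv
        rw [e1, e2]
      · obtain ⟨e1, e2⟩ := (h.seQ' hG').2.2 v u hv hu huv.symm
        rw [e1, e2]; exact Sym2.eq_swap
      · have hu' := (h.mem_or u.2).resolve_left hu
        have hv' := (h.mem_or v.2).resolve_left hv
        exact (no_reattach_R N hN x p hmem h u v huv hu' hv' y hyx (hY y hy) (hd x y)).elim

/-- Lemma 5 (leaf deletion and unique reattachment): let `x` be a leaf of a level-2
network `N` (`|X| ≥ 3`) that is not contained in a blob, with neighbour `p`, and let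
`Y ∪ Z` be the unique partition of `X \ {x}` induced by `x`.  Deleting `x` yields a
network `N'` whose multisets of distances agree with those of `N` within `Y` and
within `Z`, and are one less than those of `N` across `Y` and `Z`.  Moreover there is
exactly one edge of `N'` to which `x` can be reattached so as to obtain a network with
the same multisets of distances as `N`, and the resulting network is isomorphic to `N`. -/
theorem leaf_deletion_and_unique_reattachment
    (X : Type) [Fintype X] [DecidableEq X] (hX : 3 ≤ Fintype.card X)
    (N : LabGraph X) (hN : N.IsNetwork) (hlev : N.IsLevel 2)
    (x : X) (hx : ¬ ∃ H : N.G.Subgraph, N.IsBlob H ∧ N.LeafInBlob x H)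
    (p : N.V) (hp : N.G.Adj (N.leaf x) p)
    (hmem : ∀ a : X, a ≠ x → N.leaf a ≠ N.leaf x ∧ N.leaf a ≠ p)
    (Y Z : Set X) (hYZ : GoodPartition N x Y Z)
    (huniq : ∀ Y' Z' : Set X, GoodPartition N x Y' Z' →
      (Y' = Y ∧ Z' = Z) ∨ (Y' = Z ∧ Z' = Y)) :
    ∀ N' : LabGraph {a : X // a ≠ x}, N' = N.leafDelete x p hmem →
      ((∀ (y z : X) (hy : y ≠ x) (hz : z ≠ x),
          ((y ∈ Y ∧ z ∈ Y) ∨ (y ∈ Z ∧ z ∈ Z)) →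
          N'.dms ⟨y, hy⟩ ⟨z, hz⟩ = N.dms y z) ∧
       (∀ (y z : X) (hy : y ≠ x) (hz : z ≠ x),
          ((y ∈ Y ∧ z ∈ Z) ∨ (y ∈ Z ∧ z ∈ Y)) →
          toZ (N'.dms ⟨y, hy⟩ ⟨z, hz⟩) = zsub (N.dms y z) 1) ∧
       (∃ u v : N'.V, N'.G.Adj u v ∧
          (∀ a b : X, (reattach x N' u v).dms a b = N.dms a b) ∧
          (reattach x N' u v).IsomLabelled N ∧
          ∀ u' v' : N'.V, N'.G.Adj u' v' →
            (∀ a b : X, (reattach x N' u' v').dms a b = N.dms a b) →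
            s(u', v') = s(u, v))) := by
  obtain ⟨q, r, Q, R, h⟩ := Setup.exists_of hX N hN x hx p hp hmem
  have hc := hN.1
  have hYZ' := hYZ
  obtain ⟨hU, -, hYn, hZn, hdist⟩ := hYZ'
  have hYx : ∀ y ∈ Y, y ≠ x := by
    intro y hy
    have : y ∈ Y ∪ Z := Or.inl hy
    rw [hU] at this; exact this
  have hZx : ∀ z ∈ Z, z ≠ x := by
    intro y hy
    have : y ∈ Y ∪ Z := Or.inr hy
    rw [hU] at this; exact this
  have side : ∀ a, a ≠ x → N.leaf a ∈ Q ∨ N.leaf a ∈ R := fun a ha => h.mem_or (hmem a ha)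
  have n1 : ∀ y ∈ Y, ∀ z ∈ Z, ¬ (N.leaf y ∈ Q ∧ N.leaf z ∈ Q) := fun y hy z hz hh =>
    h.same_side_ne hc hh.1 hh.2 (hdist y hy z hz)
  have n2 : ∀ y ∈ Y, ∀ z ∈ Z, ¬ (N.leaf y ∈ R ∧ N.leaf z ∈ R) := fun y hy z hz hh =>
    h.swap.same_side_ne hc hh.1 hh.2 (hdist y hy z hz)
  obtain ⟨y₀, hy₀⟩ := Set.nonempty_iff_ne_empty.2 hYn
  obtain ⟨z₀, hz₀⟩ := Set.nonempty_iff_ne_empty.2 hZn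
  rcases side y₀ (hYx y₀ hy₀) with h0 | h0
  · have hZ : ∀ z ∈ Z, N.leaf z ∈ R := fun z hz =>
      (side z (hZx z hz)).resolve_left fun e => n1 y₀ hy₀ z hz ⟨h0, e⟩
    have hY : ∀ y ∈ Y, N.leaf y ∈ Q := fun y hy =>
      (side y (hYx y hy)).resolve_right fun e => n2 y hy z₀ hz₀ ⟨e, hZ z₀ hz₀⟩
    exact main_aux N hc x p hmem h Y Z hYZ hY hZ
  · have hZ : ∀ z ∈ Z, N.leaf z ∈ Q := fun z hz =>
      (side z (hZx z hz)).resolve_right fun e => n2 y₀ hy₀ z hz ⟨h0, e⟩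
    have hY : ∀ y ∈ Y, N.leaf y ∈ R := fun y hy =>
      (side y (hYx y hy)).resolve_left fun e => n1 y hy z₀ hz₀ ⟨e, hZ z₀ hz₀⟩
    exact main_aux N hc x p hmem h.swap Y Z hYZ hY hZ

end LabGraph
end

section
/- Let N be a level-2 phylogenetic network on X with at least two blobs in which every leaf is contained in a blob. Then N contains a pendant level-2 blob of the form (1, 0, 0, 0) containing the leaf a if and only if d_m(a, x) ≥ 6 for all x ∈ X \ {a} and d_m(a,y) + d_m(a,z) − d_m(y,z) ≥ 8 for any two leaves y, z ∈ X \ {a}. -/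
open SimpleGraph

namespace LabGraph

variable {X : Type} [Fintype X] [DecidableEq X]

/-- The branch vertices of a blob `H`: its vertices of degree at least 3 in `H`. -/
def branchVerts (N : LabGraph X) (H : N.G.Subgraph) : Set N.V :=
  {w | w ∈ H.verts ∧ 3 ≤ (H.neighborSet w).ncard}

/-- `p` and `q` lie on a common side of the blob `H`: they are non-branch vertices of `H`
that are connected in `H` after deleting all branch vertices. -/
def SameSide (N : LabGraph X) (H : N.G.Subgraph) (p q : N.V) : Prop :=
  ∃ (hp : p ∈ (H.deleteVerts (N.branchVerts H)).verts)
    (hq : q ∈ (H.deleteVerts (N.branchVerts H)).verts),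
    (H.deleteVerts (N.branchVerts H)).coe.Reachable ⟨p, hp⟩ ⟨q, hq⟩

/-- `p` and `q` are separated by the vertex `u` within the sides of the blob `H`:
they are not connected in `H` after deleting all branch vertices and `u`. -/
def SepBy (N : LabGraph X) (H : N.G.Subgraph) (u p q : N.V) : Prop :=
  ¬ ∃ (hp : p ∈ (H.deleteVerts (N.branchVerts H ∪ {u})).verts)
      (hq : q ∈ (H.deleteVerts (N.branchVerts H ∪ {u})).verts),
      (H.deleteVerts (N.branchVerts H ∪ {u})).coe.Reachable ⟨p, hp⟩ ⟨q, hq⟩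

/-- The pendant level-2 blob `H` is of the form `(k, l, m, n)`, witnessed by the chains
`a, b, c, d` and the non-trivial cut-edge `s(u, w)` with `u ∈ H`: the chains `c` and `d`
lie on the same side of `H` as the cut-edge (separated by its endpoint `u`), the chains
`a` and `b` lie on two further (distinct) sides, and `a, b, c, d` are precisely the
(maximal) chains contained in `H`. A length-0 chain denotes a side without leaves. -/
def IsFormBlob (N : LabGraph X) (H : N.G.Subgraph) (u w : N.V) (k l m n : ℕ)
    (a : Fin k → X) (b : Fin l → X) (c : Fin m → X) (d : Fin n → X) : Prop :=
  N.IsPendantBlob H ∧ N.BlobRank H 2 ∧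
  N.IsCutEdge s(u, w) ∧ ¬ N.TrivialEdge s(u, w) ∧ u ∈ H.verts ∧ w ∉ H.verts ∧
  (0 < k → N.IsMaxChainT k a) ∧ (0 < l → N.IsMaxChainT l b) ∧
  (0 < m → N.IsMaxChainT m c) ∧ (0 < n → N.IsMaxChainT n d) ∧
  Function.Injective a ∧ Function.Injective b ∧
  Function.Injective c ∧ Function.Injective d ∧
  (Set.range a ∩ Set.range b = ∅) ∧ (Set.range a ∩ Set.range c = ∅) ∧
  (Set.range a ∩ Set.range d = ∅) ∧ (Set.range b ∩ Set.range c = ∅) ∧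
  (Set.range b ∩ Set.range d = ∅) ∧ (Set.range c ∩ Set.range d = ∅) ∧
  (∀ x : X, N.LeafInBlob x H ↔
    (x ∈ Set.range a ∨ x ∈ Set.range b ∨ x ∈ Set.range c ∨ x ∈ Set.range d)) ∧
  N.ChainInBlob k a H ∧ N.ChainInBlob l b H ∧ N.ChainInBlob m c H ∧ N.ChainInBlob n d H ∧
  (∀ (i : Fin k) (j : Fin l) (p q : N.V),
    N.G.Adj (N.leaf (a i)) p → N.G.Adj (N.leaf (b j)) q → ¬ N.SameSide H p q) ∧
  (∀ (i : Fin k) (p : N.V), N.G.Adj (N.leaf (a i)) p → ¬ N.SameSide H p u) ∧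
  (∀ (j : Fin l) (q : N.V), N.G.Adj (N.leaf (b j)) q → ¬ N.SameSide H q u) ∧
  (∀ (i : Fin m) (p : N.V), N.G.Adj (N.leaf (c i)) p → N.SameSide H p u) ∧
  (∀ (j : Fin n) (q : N.V), N.G.Adj (N.leaf (d j)) q → N.SameSide H q u) ∧
  (∀ (i : Fin m) (j : Fin n) (p q : N.V),
    N.G.Adj (N.leaf (c i)) p → N.G.Adj (N.leaf (d j)) q → N.SepBy H u p q)


set_option linter.unusedSectionVars false

section Helpers

variable {V : Type} {G : SimpleGraph V}

lemma coe_conn_iff (K : G.Subgraph) : K.coe.Connected ↔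
    K.verts.Nonempty ∧ ∀ a ∈ K.verts, ∀ b ∈ K.verts, K.spanningCoe.Reachable a b := by
  constructor
  · intro h
    refine ⟨by have := h.nonempty; exact Set.nonempty_coe_sort.mp this, ?_⟩
    intro a ha b hb
    have := h.preconnected ⟨a, ha⟩ ⟨b, hb⟩
    exact this.map (⟨fun z => z.1, fun h => h⟩ : K.coe →g K.spanningCoe)
  · rintro ⟨hne, h⟩
    have key : ∀ a b (w : K.spanningCoe.Walk a b) (ha : a ∈ K.verts) (hb : b ∈ K.verts),
        K.coe.Reachable ⟨a, ha⟩ ⟨b, hb⟩ := by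
      intro a b w
      induction w with
      | nil => intro ha hb; rfl
      | @cons a c b hac w ih =>
        intro ha hb
        have hac' : K.Adj a c := hac
        have hc : c ∈ K.verts := K.edge_vert hac'.symm
        have h1 : K.coe.Adj ⟨a, ha⟩ ⟨c, hc⟩ := hac'
        exact h1.reachable.trans (ih hc hb)
    have : Nonempty K.verts := hne.to_subtype
    refine ⟨?_⟩
    rintro ⟨a, ha⟩ ⟨b, hb⟩
    obtain ⟨w⟩ := h a ha b hb
    exact key a b w ha hb

lemma walk_reach {G' : SimpleGraph V} {a b : V} (w : G.Walk a b)
    (h : ∀ c d, s(c, d) ∈ w.edges → G'.Adj c d) : G'.Reachable a b := by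
  refine ⟨w.transfer G' ?_⟩
  intro e
  induction e with
  | h c d => exact h c d

lemma del_reach {a b c d : V} (w : G.Walk a b) (h : s(c, d) ∉ w.edges) :
    (G.deleteEdges {s(c, d)}).Reachable a b := by
  refine walk_reach w ?_
  intro e f hef
  rw [deleteEdges_adj]
  refine ⟨w.adj_of_mem_edges hef, ?_⟩
  rintro h'
  exact h (h' ▸ hef)

/-- the subgraph reachability gives deleted graph reachability -/
lemma sub_del_reach (K : G.Subgraph) {a b c d : V} (h : K.spanningCoe.Reachable a b)
    (hcd : ¬ K.Adj c d) : (G.deleteEdges {s(c, d)}).Reachable a b := by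
  refine h.mono ?_
  intro e f hef
  have hef' : K.Adj e f := hef
  rw [deleteEdges_adj]
  refine ⟨hef'.adj_sub, ?_⟩
  intro h'
  rw [Set.mem_singleton_iff, Sym2.eq_iff] at h'
  rcases h' with ⟨rfl, rfl⟩ | ⟨rfl, rfl⟩
  · exact hcd hef'
  · exact hcd hef'.symm

lemma del_adj_reach {a b c d : V} (h : G.Adj a b) (hne : s(a, b) ≠ s(c, d)) :
    (G.deleteEdges {s(c, d)}).Reachable a b := by
  apply Adj.reachable
  rw [deleteEdges_adj]
  exact ⟨h, hne⟩

/-- distance through the end of a bridge -/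
lemma dist_bridge (hG : G.Connected) {v v' y t : V}
    (hb : ¬ (G.deleteEdges {s(v, v')}).Reachable v v')
    (hy : (G.deleteEdges {s(v, v')}).Reachable v' y)
    (ht : (G.deleteEdges {s(v, v')}).Reachable v t) :
    G.dist y v + G.dist v t ≤ G.dist y t := by
  classical
  obtain ⟨w, hw⟩ := hG.exists_walk_length_eq_dist y t
  have hv : v ∈ w.support := by
    by_contra hv
    have : s(v, v') ∉ w.edges := fun h => hv (w.fst_mem_support_of_mem_edges h)
    exact hb (ht.trans ((del_reach w this).symm.trans hy.symm))
  have h1 := G.dist_le (w.takeUntil v hv)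
  have h2 := G.dist_le (w.dropUntil v hv)
  have h3 : (w.takeUntil v hv).length + (w.dropUntil v hv).length = w.length := by
    rw [← Walk.length_append, Walk.take_spec]
  omega

lemma dist_bridge' (hG : G.Connected) {v v' y t : V}
    (hb : ¬ (G.deleteEdges {s(v, v')}).Reachable v v')
    (hy : (G.deleteEdges {s(v, v')}).Reachable v' y)
    (ht : (G.deleteEdges {s(v, v')}).Reachable v t) :
    G.dist y v' + G.dist v' t ≤ G.dist y t := by
  have hs : s(v', v) = s(v, v') := Sym2.eq_swap
  have h := dist_bridge hG (v := v') (v' := v) (y := t) (t := y)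
    (by rw [hs]; exact fun h => hb h.symm) (by rw [hs]; exact ht) (by rw [hs]; exact hy)
  rw [G.dist_comm (u := y) (v := v'), G.dist_comm (u := v') (v := t), G.dist_comm (u := y) (v := t)]
  omega

/-- first entry into a set -/
lemma first_entry {S : Set V} {x q : V} (w : G.Walk x q) (hx : x ∉ S) (hq : q ∈ S) :
    ∃ v' v, ∃ w' : G.Walk x v', (∀ z ∈ w'.support, z ∉ S) ∧ v' ∉ S ∧ v ∈ S ∧ G.Adj v' v := by
  induction w with
  | nil => exact absurd hq hx
  | @cons x c q h w ih =>
    by_cases hc : c ∈ S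
    · exact ⟨x, c, Walk.nil, by simpa using hx, hx, hc, h⟩
    · obtain ⟨v', v, w', h1, h2, h3, h4⟩ := ih hc hq
      refine ⟨v', v, Walk.cons h w', ?_, h2, h3, h4⟩
      intro z hz
      rw [Walk.support_cons, List.mem_cons] at hz
      rcases hz with rfl | hz
      · exact hx
      · exact h1 z hz

end Helpers

lemma TwoConnSub.conn {N : LabGraph X} {H : N.G.Subgraph} (h : N.TwoConnSub H) {a b : N.V}
    (ha : a ∈ H.verts) (hb : b ∈ H.verts) : H.spanningCoe.Reachable a b :=
  ((coe_conn_iff H).1 h.2.1).2 a ha b hb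

lemma TwoConnSub.conn_del {N : LabGraph X} {H : N.G.Subgraph} (h : N.TwoConnSub H) (v : N.V)
    {a b : N.V} (ha : a ∈ H.verts) (hb : b ∈ H.verts) (hav : a ≠ v) (hbv : b ≠ v) :
    (H.deleteVerts {v}).spanningCoe.Reachable a b := by
  by_cases hv : v ∈ H.verts
  · exact ((coe_conn_iff _).1 (h.2.2 v hv)).2 a ⟨ha, hav⟩ b ⟨hb, hbv⟩
  · refine (h.conn ha hb).mono ?_
    intro c d hcd
    have hcd' : H.Adj c d := hcd
    have : (H.deleteVerts {v}).Adj c d := by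
      rw [Subgraph.deleteVerts_adj]
      have h1 := H.edge_vert hcd'
      have h2 := H.edge_vert hcd'.symm
      exact ⟨h1, fun e => hv (e ▸ h1), h2, fun e => hv (e ▸ h2), hcd'⟩
    exact this

lemma twoConn_mk {N : LabGraph X} {H : N.G.Subgraph} (h3 : 3 ≤ H.verts.ncard)
    (h1 : ∀ a ∈ H.verts, ∀ b ∈ H.verts, H.spanningCoe.Reachable a b)
    (h2 : ∀ v ∈ H.verts, ∀ a ∈ H.verts, ∀ b ∈ H.verts, a ≠ v → b ≠ v →
      (H.deleteVerts {v}).spanningCoe.Reachable a b) : N.TwoConnSub H := by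
  refine ⟨h3, (coe_conn_iff H).2 ⟨?_, h1⟩, ?_⟩
  · apply Set.nonempty_of_ncard_ne_zero; omega
  · intro v hv
    refine (coe_conn_iff _).2 ⟨?_, ?_⟩
    · obtain ⟨a, ha, hav⟩ := Set.exists_ne_of_one_lt_ncard (s := H.verts) (by omega) v
      exact ⟨a, ha, hav⟩
    · rintro a ⟨ha, hav⟩ b ⟨hb, hbv⟩
      exact h2 v hv a ha b hb hav hbv

lemma twoConn_sup {N : LabGraph X} {H K : N.G.Subgraph} (hH : N.TwoConnSub H)
    (hK : N.TwoConnSub K) {r s : N.V} (hrs : r ≠ s) (hrH : r ∈ H.verts) (hsH : s ∈ H.verts)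
    (hrK : r ∈ K.verts) (hsK : s ∈ K.verts) : N.TwoConnSub (H ⊔ K) := by
  have mono : ∀ (A B : N.G.Subgraph), A ≤ B → ∀ v, (A.deleteVerts {v}).spanningCoe ≤
      (B.deleteVerts {v}).spanningCoe := by
    intro A B h v c d hcd
    have h1 : (A.deleteVerts {v}).Adj c d := hcd
    have : (B.deleteVerts {v}).Adj c d := by
      rw [Subgraph.deleteVerts_adj] at h1 ⊢
      exact ⟨h.1 h1.1, h1.2.1, h.1 h1.2.2.1, h1.2.2.2.1, h.2 h1.2.2.2.2⟩
    exact this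
  refine twoConn_mk ?_ ?_ ?_
  · exact hH.1.trans (Set.ncard_le_ncard (le_sup_left : H ≤ H ⊔ K).1 (Set.toFinite _))
  · have key : ∀ a ∈ (H ⊔ K).verts, (H ⊔ K).spanningCoe.Reachable a r := by
      rintro a (ha | ha)
      · exact (hH.conn ha hrH).mono (fun c d h => Or.inl h)
      · exact (hK.conn ha hrK).mono (fun c d h => Or.inr h)
    intro a ha b hb
    exact (key a ha).trans (key b hb).symm
  · intro v _
    obtain ⟨t, htv, htH, htK⟩ : ∃ t, t ≠ v ∧ t ∈ H.verts ∧ t ∈ K.verts := by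
      by_cases h : r = v
      · exact ⟨s, fun h' => hrs (h.trans h'.symm), hsH, hsK⟩
      · exact ⟨r, h, hrH, hrK⟩
    have key : ∀ a ∈ (H ⊔ K).verts, a ≠ v →
        ((H ⊔ K).deleteVerts {v}).spanningCoe.Reachable a t := by
      rintro a (ha | ha) hav
      · exact (hH.conn_del v ha htH hav htv).mono (mono _ _ le_sup_left v)
      · exact (hK.conn_del v ha htK hav htv).mono (mono _ _ le_sup_right v)
    intro a ha b hb hav hbv
    exact (key a ha hav).trans (key b hb hbv).symm

/-- Every edge whose ends stay connected without it lies in a cycle, which is 2-connected. -/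
lemma cycle_twoConn {N : LabGraph X} {v v' : N.V} (hadj : N.G.Adj v v')
    (hr : (N.G.deleteEdges {s(v, v')}).Reachable v v') :
    ∃ C : N.G.Subgraph, N.TwoConnSub C ∧ C.Adj v v' ∧ ∃ n, C.Adj v n ∧ n ≠ v' := by
  classical
  obtain ⟨w0, hw0⟩ := hr.exists_isPath
  obtain ⟨q, hq, hqe⟩ : ∃ q : N.G.Walk v v', q.IsPath ∧ s(v, v') ∉ q.edges := by
    refine ⟨w0.mapLe (deleteEdges_le _), ?_, ?_⟩
    · exact (Walk.isPath_mapLe _).2 hw0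
    · rw [Walk.edges_mapLe_eq_edges]
      intro h
      have := w0.adj_of_mem_edges h
      rw [deleteEdges_adj] at this
      exact this.2 rfl
  let C : N.G.Subgraph := q.toSubgraph ⊔ N.G.subgraphOfAdj hadj
  have hverts : ∀ y, y ∈ C.verts ↔ y ∈ q.support := by
    intro y
    constructor
    · rintro (h | h)
      · exact (q.mem_verts_toSubgraph).1 h
      · rcases h with rfl | rfl
        · exact q.start_mem_support
        · exact q.end_mem_support
    · intro h
      exact Or.inl ((q.mem_verts_toSubgraph).2 h)
  have hCe : ∀ c d, s(c, d) ∈ q.edges → C.Adj c d := fun c d h =>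
    Or.inl (Walk.adj_toSubgraph_iff_mem_edges.2 h)
  have hCv : C.Adj v v' := Or.inr rfl
  obtain ⟨n, hvn, hnv'⟩ : ∃ n, C.Adj v n ∧ n ≠ v' := by
    cases q with
    | nil => exact absurd rfl hadj.ne
    | @cons _ n _ h q' =>
      refine ⟨n, hCe v n (by simp), ?_⟩
      rintro rfl
      exact hqe (by simp)
  have hside : ∀ x y, y ∈ q.support → y ≠ x →
      (x ∉ (C.verts : Set N.V) ∨ x ≠ v → (C.deleteVerts {x}).spanningCoe.Reachable y v ∨
        (C.deleteVerts {x}).spanningCoe.Reachable y v') ∧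
      ((x = v → (C.deleteVerts {x}).spanningCoe.Reachable y v') ∧
      (x = v' → (C.deleteVerts {x}).spanningCoe.Reachable y v)) := by
    intro x y hy hyx
    have htd : x ∉ (q.takeUntil y hy).support ∨ x ∉ (q.dropUntil y hy).support := by
      by_contra hcon
      push Not at hcon
      obtain ⟨h1, h2⟩ := hcon
      have hnd := hq.support_nodup
      rw [← Walk.take_spec q hy, Walk.support_append] at hnd
      have hdis := (List.nodup_append'.1 hnd).2.2
      rw [Walk.mem_support_iff] at h2
      rcases h2 with h2 | h2
      · exact hyx h2.symm
      · exact hdis h1 h2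
    have del_of : ∀ {a b : N.V} (w : N.G.Walk a b), (∀ e ∈ w.edges, e ∈ q.edges) →
        x ∉ w.support → (C.deleteVerts {x}).spanningCoe.Reachable a b := by
      intro a b w hwe hx
      refine walk_reach w ?_
      intro c d hcd
      have h1 : C.Adj c d := hCe c d (hwe _ hcd)
      have : (C.deleteVerts {x}).Adj c d := by
        rw [Subgraph.deleteVerts_adj]
        exact ⟨C.edge_vert h1, fun e => hx (e ▸ w.fst_mem_support_of_mem_edges hcd),
          C.edge_vert h1.symm, fun e => hx (e ▸ w.snd_mem_support_of_mem_edges hcd), h1⟩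
      exact this
    have ht : x ∉ (q.takeUntil y hy).support → (C.deleteVerts {x}).spanningCoe.Reachable y v :=
      fun h => (del_of _ (fun e he => q.edges_takeUntil_subset_edges hy he) h).symm
    have hd : x ∉ (q.dropUntil y hy).support → (C.deleteVerts {x}).spanningCoe.Reachable y v' :=
      fun h => del_of _ (fun e he => q.edges_dropUntil_subset_edges hy he) h
    refine ⟨fun _ => htd.imp ht hd, ?_, ?_⟩
    · rintro rfl
      exact hd (htd.resolve_left (fun h => h (Walk.start_mem_support _)))
    · rintro rfl
      exact ht (htd.resolve_right (fun h => h (Walk.end_mem_support _)))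
  refine ⟨C, ?_, hCv, n, hvn, hnv'⟩
  refine twoConn_mk ?_ ?_ ?_
  · have hsub : ({v, v', n} : Set N.V) ⊆ C.verts := by
      rintro z (rfl | rfl | rfl)
      · exact C.edge_vert hCv
      · exact C.edge_vert hCv.symm
      · exact C.edge_vert hvn.symm
    have h3 : ({v, v', n} : Set N.V).ncard = 3 :=
      Set.ncard_eq_three.2 ⟨v, v', n, hadj.ne, hvn.ne, hnv'.symm, rfl⟩
    rw [← h3]
    exact Set.ncard_le_ncard hsub (Set.toFinite _)
  · have key : ∀ y ∈ C.verts, C.spanningCoe.Reachable y v := by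
      intro y hy
      have hy' := (hverts y).1 hy
      exact (walk_reach (G' := C.spanningCoe) (q.takeUntil y hy')
        (fun c d h => hCe c d (q.edges_takeUntil_subset_edges hy' h))).symm
    intro a ha b hb
    exact (key a ha).trans (key b hb).symm
  · intro x _ a ha b hb hax hbx
    have ha' := (hverts a).1 ha
    have hb' := (hverts b).1 hb
    by_cases hxv : x = v
    · exact ((hside x a ha' hax).2.1 hxv).trans ((hside x b hb' hbx).2.1 hxv).symm
    by_cases hxv' : x = v'
    · exact ((hside x a ha' hax).2.2 hxv').trans ((hside x b hb' hbx).2.2 hxv').symm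
    have hvv' : (C.deleteVerts {x}).spanningCoe.Reachable v v' := by
      apply Adj.reachable
      have : (C.deleteVerts {x}).Adj v v' := by
        rw [Subgraph.deleteVerts_adj]
        exact ⟨C.edge_vert hCv, fun e => hxv e.symm, C.edge_vert hCv.symm, fun e => hxv' e.symm, hCv⟩
      exact this
    have key : ∀ y ∈ q.support, y ≠ x → (C.deleteVerts {x}).spanningCoe.Reachable y v := by
      intro y hy hyx
      rcases (hside x y hy hyx).1 (Or.inr hxv) with h | h
      · exact h
      · exact h.trans hvv'.symm
    exact (key a ha' hax).trans (key b hb' hbx).symm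

lemma exists_blob_ge {N : LabGraph X} {C : N.G.Subgraph} (hC : N.TwoConnSub C) :
    ∃ B, N.IsBlob B ∧ C ≤ B := by
  obtain ⟨B, hCB, hB⟩ := (Set.toFinite {K : N.G.Subgraph | N.TwoConnSub K}).exists_le_maximal hC
  exact ⟨B, ⟨hB.1, fun H' hH' hle => le_antisymm (hB.2 hH' hle) hle⟩, hCB⟩

/-- minimum degree two -/
lemma TwoConnSub.two_nbrs {N : LabGraph X} {H : N.G.Subgraph} (h : N.TwoConnSub H) {v : N.V}
    (hv : v ∈ H.verts) : ∃ n m, n ≠ m ∧ H.Adj v n ∧ H.Adj v m := by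
  have first : ∀ (K : N.G.Subgraph) (b : N.V), b ≠ v → K.spanningCoe.Reachable v b →
      ∃ n, K.Adj v n := by
    rintro K b hb ⟨w⟩
    cases w with
    | nil => exact absurd rfl hb
    | @cons _ n _ h _ => exact ⟨n, h⟩
  obtain ⟨b, hb, hbv⟩ := Set.exists_ne_of_one_lt_ncard (s := H.verts) (by have := h.1; omega) v
  obtain ⟨n, hn⟩ := first H b hbv (h.conn hv hb)
  obtain ⟨c, hc, hcv⟩ : ∃ c ∈ H.verts, c ∉ ({v, n} : Set N.V) := by
    by_contra hcon
    push Not at hcon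
    have h1 := Set.ncard_le_ncard (show H.verts ⊆ {v, n} from hcon) (Set.toFinite _)
    have h2 := Set.ncard_pair hn.ne
    have := h.1
    omega
  simp only [Set.mem_insert_iff, Set.mem_singleton_iff, not_or] at hcv
  obtain ⟨m, hm⟩ := first (H.deleteVerts {n}) c hcv.1 (h.conn_del n hv hc hn.ne hcv.2)
  rw [Subgraph.deleteVerts_adj] at hm
  exact ⟨n, m, fun e => hm.2.2.2.1 e.symm, hn, hm.2.2.2.2⟩

/-- an edge of a 2-connected subgraph is not a bridge -/
lemma TwoConnSub.not_bridge {N : LabGraph X} {H : N.G.Subgraph} (h : N.TwoConnSub H) {x y : N.V}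
    (hxy : H.Adj x y) : (N.G.deleteEdges {s(x, y)}).Reachable x y := by
  obtain ⟨r, hr, hry⟩ : ∃ r, H.Adj x r ∧ r ≠ y := by
    obtain ⟨n, m, hnm, hn, hm⟩ := h.two_nbrs (H.edge_vert hxy)
    by_cases hny : n = y
    · exact ⟨m, hm, fun e => hnm (hny.trans e.symm)⟩
    · exact ⟨n, hn, hny⟩
  have h1 := h.conn_del x (H.edge_vert hr.symm) (H.edge_vert hxy.symm) hr.ne.symm hxy.ne.symm
  have h2 : (N.G.deleteEdges {s(x, y)}).Reachable r y := by
    refine sub_del_reach _ h1 ?_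
    rw [Subgraph.deleteVerts_adj]
    intro h'
    exact h'.2.1 rfl
  refine (del_adj_reach hr.adj_sub ?_).trans h2
  intro e
  rw [Sym2.eq_iff] at e
  rcases e with e | e
  · exact hry e.2
  · exact hxy.ne e.1

/-- the degree conditions of a (non-singleton) network -/
def DegOK (N : LabGraph X) : Prop :=
  (∀ x : X, N.degOf (N.leaf x) = 1) ∧ ∀ v : N.V, v ∉ Set.range N.leaf → N.degOf v = 3

lemma degOK_of {N : LabGraph X} (hN : N.IsNetwork) (hb : N.TwoBlobs) : N.DegOK := by
  rcases hN.2.2 with h | h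
  · obtain ⟨H, _, hH, _⟩ := hb
    have h1 := hH.1.1
    have h2 := Set.ncard_le_ncard (Set.subset_univ H.verts) (Set.toFinite _)
    rw [Set.ncard_univ, Nat.card_eq_fintype_card] at h2
    omega
  · exact h

lemma DegOK.leaf_nbr {N : LabGraph X} (hD : N.DegOK) {x : X} {p q : N.V}
    (hp : N.G.Adj (N.leaf x) p) (hq : N.G.Adj (N.leaf x) q) : p = q := by
  obtain ⟨c, hc⟩ := Set.ncard_eq_one.1 (hD.1 x)
  have h1 : p ∈ N.G.neighborSet (N.leaf x) := hp
  have h2 : q ∈ N.G.neighborSet (N.leaf x) := hq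
  rw [hc] at h1 h2
  exact h1.trans h2.symm

lemma DegOK.le3 {N : LabGraph X} (hD : N.DegOK) (v : N.V) : (N.G.neighborSet v).ncard ≤ 3 := by
  by_cases h : v ∈ Set.range N.leaf
  · obtain ⟨x, rfl⟩ := h
    have := hD.1 x
    unfold degOf at this
    omega
  · exact (hD.2 v h).le

lemma DegOK.mem3 {N : LabGraph X} (hD : N.DegOK) {v a b c d : N.V} (ha : N.G.Adj v a)
    (hb : N.G.Adj v b) (hc : N.G.Adj v c) (hab : a ≠ b) (hac : a ≠ c) (hbc : b ≠ c)
    (hd : N.G.Adj v d) : d = a ∨ d = b ∨ d = c := by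
  have h3 : ({a, b, c} : Set N.V).ncard = 3 := Set.ncard_eq_three.2 ⟨a, b, c, hab, hac, hbc, rfl⟩
  have hsub : ({a, b, c} : Set N.V) ⊆ N.G.neighborSet v := by
    rintro z (rfl | rfl | rfl)
    · exact ha
    · exact hb
    · exact hc
  have := Set.eq_of_subset_of_ncard_le hsub (by rw [h3]; exact hD.le3 v) (Set.toFinite _)
  have hd' : d ∈ N.G.neighborSet v := hd
  rw [← this] at hd'
  exact hd'

lemma DegOK.not_leaf {N : LabGraph X} (hD : N.DegOK) {H : N.G.Subgraph} (h : N.TwoConnSub H)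
    {v : N.V} (hv : v ∈ H.verts) (x : X) : N.leaf x ≠ v := by
  rintro rfl
  obtain ⟨n, m, hnm, hn, hm⟩ := h.two_nbrs hv
  exact hnm (hD.leaf_nbr hn.adj_sub hm.adj_sub)

lemma blob_bridge {N : LabGraph X} (hD : N.DegOK) {B : N.G.Subgraph} (hB : N.IsBlob B)
    {v v' : N.V} (hv : v ∈ B.verts) (hadj : N.G.Adj v v') (hnB : ¬ B.Adj v v') :
    ¬ (N.G.deleteEdges {s(v, v')}).Reachable v v' := by
  intro hr
  obtain ⟨C, hC, hCv, n, hvn, hnv'⟩ := cycle_twoConn hadj hr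
  obtain ⟨m1, m2, hm, h1, h2⟩ := hB.1.two_nbrs hv
  have hn : n ∈ B.verts := by
    rcases hD.mem3 h1.adj_sub h2.adj_sub hadj hm (fun e => hnB (e ▸ h1)) (fun e => hnB (e ▸ h2))
      hvn.adj_sub with rfl | rfl | rfl
    · exact B.edge_vert h1.symm
    · exact B.edge_vert h2.symm
    · exact absurd rfl hnv'
  have hsup := twoConn_sup hB.1 hC hvn.ne hv hn (C.edge_vert hvn) (C.edge_vert hvn.symm)
  have heq := hB.2 _ hsup le_sup_left
  have : (B ⊔ C).Adj v v' := Or.inr hCv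
  rw [heq] at this
  exact hnB this

lemma out_edge {N : LabGraph X} (hD : N.DegOK) {B : N.G.Subgraph} (hB : N.TwoConnSub B)
    {v : N.V} (hv : v ∈ B.verts) (hbr : ¬ 3 ≤ (B.neighborSet v).ncard) :
    ∃ v', N.G.Adj v v' ∧ ¬ B.Adj v v' := by
  by_contra hcon
  push Not at hcon
  have h3 : N.degOf v = 3 := hD.2 v (by rintro ⟨x, hx⟩; exact hD.not_leaf hB hv x hx)
  apply hbr
  rw [← h3]
  exact Set.ncard_le_ncard (fun z hz => hcon z hz) (Set.toFinite _)

lemma deg_sum {N : LabGraph X} (H : N.G.Subgraph) :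
    ∑ v, (H.neighborSet v).ncard = 2 * H.edgeSet.ncard := by
  classical
  have h := H.spanningCoe.sum_degrees_eq_twice_card_edges
  have h1 : ∀ v, H.spanningCoe.degree v = (H.neighborSet v).ncard := by
    intro v
    rw [← SimpleGraph.card_neighborSet_eq_degree, ← Nat.card_eq_fintype_card]
    rfl
  have h2 : H.spanningCoe.edgeFinset.card = H.edgeSet.ncard := by
    rw [← Set.ncard_coe_finset, SimpleGraph.coe_edgeFinset, Subgraph.edgeSet_spanningCoe]
  rw [← h2, ← h]
  exact Finset.sum_congr rfl (fun v _ => (h1 v).symm)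

lemma branch_ineq {N : LabGraph X} {B : N.G.Subgraph} (hB : N.TwoConnSub B) :
    2 * B.verts.ncard + (N.branchVerts B).ncard ≤ 2 * B.edgeSet.ncard := by
  classical
  have h := deg_sum B
  have hle : ∀ v : N.V, (if v ∈ B.verts then 2 else 0) + (if v ∈ N.branchVerts B then 1 else 0) ≤
      (B.neighborSet v).ncard := by
    intro v
    by_cases hv : v ∈ B.verts
    · by_cases hbr : v ∈ N.branchVerts B
      · simp only [hv, hbr, if_true]
        exact hbr.2
      · simp only [hv, hbr, if_true, if_false]
        obtain ⟨n, m, hnm, hn, hm⟩ := hB.two_nbrs hv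
        have : ({n, m} : Set N.V) ⊆ B.neighborSet v := by
          rintro z (rfl | rfl)
          · exact hn
          · exact hm
        have h2 := Set.ncard_le_ncard this (Set.toFinite _)
        rw [Set.ncard_pair hnm] at h2
        exact h2
    · have hbr : v ∉ N.branchVerts B := fun h => hv h.1
      simp [hv, hbr]
  have hs := Finset.sum_le_sum (s := Finset.univ) (fun v _ => hle v)
  rw [h, Finset.sum_add_distrib] at hs
  have e1 : ∑ v : N.V, (if v ∈ B.verts then 2 else 0) = 2 * B.verts.ncard := by
    rw [← Finset.sum_filter, Finset.sum_const, Set.ncard_eq_toFinset_card', smul_eq_mul, mul_comm]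
    congr 2
    ext z
    simp
  have e2 : ∑ v : N.V, (if v ∈ N.branchVerts B then 1 else 0) = (N.branchVerts B).ncard := by
    rw [← Finset.sum_filter, Finset.sum_const, Set.ncard_eq_toFinset_card', smul_eq_mul, mul_one]
    congr 1
    ext z
    simp
  omega

lemma branch_le {N : LabGraph X} {B : N.G.Subgraph} (hB : N.TwoConnSub B)
    (hlev : B.edgeSet.ncard + 1 ≤ B.verts.ncard + 2) : (N.branchVerts B).ncard ≤ 2 := by
  have := branch_ineq hB
  omega

lemma branch_three {N : LabGraph X} {B : N.G.Subgraph} (h : (N.branchVerts B).ncard ≤ 2)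
    {x y z : N.V} (hx : x ∈ N.branchVerts B) (hy : y ∈ N.branchVerts B) (hz : z ∈ N.branchVerts B)
    (hxy : x ≠ y) (hxz : x ≠ z) (hyz : y ≠ z) : False := by
  have h3 : ({x, y, z} : Set N.V).ncard = 3 := Set.ncard_eq_three.2 ⟨x, y, z, hxy, hxz, hyz, rfl⟩
  have hsub : ({x, y, z} : Set N.V) ⊆ N.branchVerts B := by
    rintro t (rfl | rfl | rfl)
    · exact hx
    · exact hy
    · exact hz
  have := Set.ncard_le_ncard hsub (Set.toFinite _)
  omega

/-- a branch vertex has three neighbours in the blob -/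
lemma branch_nbrs {N : LabGraph X} {B : N.G.Subgraph} {x : N.V} (hx : x ∈ N.branchVerts B) (p : N.V) :
    ∃ n m, n ≠ m ∧ n ≠ p ∧ m ≠ p ∧ B.Adj x n ∧ B.Adj x m := by
  have h1 : 1 < (B.neighborSet x \ {p}).ncard := by
    have := Set.ncard_sdiff_singleton_le (B.neighborSet x) p
    have h2 := Set.le_ncard_sdiff {p} (B.neighborSet x) (Set.toFinite _)
    rw [Set.ncard_singleton] at h2
    have := hx.2
    omega
  obtain ⟨n, m, hn, hm, hnm⟩ := (Set.one_lt_ncard_iff (Set.toFinite _)).1 h1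
  exact ⟨n, m, hnm, hn.2, hm.2, hn.1, hm.1⟩

/-- in a blob with at most two branch vertices, there is a non-branch vertex other than p -/
lemma other_nonbranch {N : LabGraph X} {B : N.G.Subgraph} (hB : N.TwoConnSub B)
    (h : (N.branchVerts B).ncard ≤ 2) (p : N.V) :
    ∃ v ∈ B.verts, v ≠ p ∧ v ∉ N.branchVerts B := by
  by_contra hcon
  push Not at hcon
  obtain ⟨s, hs, hsp⟩ := Set.exists_ne_of_one_lt_ncard (s := B.verts) (by have := hB.1; omega) p
  have hbs := hcon s hs hsp
  obtain ⟨n, m, hnm, hn, hm, hsn, hsm⟩ := branch_nbrs hbs p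
  exact branch_three h hbs (hcon n (B.edge_vert hsn.symm) hn) (hcon m (B.edge_vert hsm.symm) hm)
    hsn.ne hsm.ne hnm

/-- behind every bridge there is a leaf -/
lemma leaf_behind {N : LabGraph X} (hD : N.DegOK) (hlev : N.IsLevel 2) :
    ∀ (k : ℕ) (v v' : N.V), {y | (N.G.deleteEdges {s(v, v')}).Reachable v' y}.ncard = k →
      N.G.Adj v v' → ¬ (N.G.deleteEdges {s(v, v')}).Reachable v v' →
      ∃ x : X, (N.G.deleteEdges {s(v, v')}).Reachable v' (N.leaf x) := by
  intro k
  induction k using Nat.strong_induction_on with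
  | _ k ih =>
  intro v v' hk hadj hb
  by_cases hleaf : v' ∈ Set.range N.leaf
  · obtain ⟨x, rfl⟩ := hleaf
    exact ⟨x, Reachable.refl _⟩
  -- a smaller side suffices
  have step : ∀ c c', N.G.Adj c c' → ¬ (N.G.deleteEdges {s(c, c')}).Reachable c c' →
      (N.G.deleteEdges {s(v, v')}).Reachable v' c →
      (N.G.deleteEdges {s(c, c')}).Reachable v' c → c' ≠ v →
      ∃ x : X, (N.G.deleteEdges {s(v, v')}).Reachable v' (N.leaf x) := by
    intro c c' hcc hcb hvc hc'v hc'
    have hcv : c ≠ v := by rintro rfl; exact hb hvc.symm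
    have hne : s(v', v) ≠ s(c, c') := by
      intro e
      rw [Sym2.eq_iff] at e
      rcases e with e | e
      · exact hc' e.2.symm
      · exact hcv e.2.symm
    have hv'v : (N.G.deleteEdges {s(c, c')}).Reachable v' v := del_adj_reach hadj.symm hne
    have hsub : ∀ y, (N.G.deleteEdges {s(c, c')}).Reachable c' y →
        (N.G.deleteEdges {s(v, v')}).Reachable v' y := by
      intro y hy
      have h1 : (N.G.deleteEdges {s(v, v')}).Reachable c c' := by
        refine del_adj_reach hcc ?_
        rw [Sym2.eq_swap (a := v)]
        exact hne.symm
      refine hvc.trans (h1.trans ?_)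
      obtain ⟨w⟩ := hy
      have hvw : v ∉ w.support := by
        classical
        intro hvw
        exact hcb (hc'v.symm.trans (hv'v.trans (w.takeUntil v hvw).reachable.symm))
      refine walk_reach w ?_
      intro e f hef
      have h2 := w.adj_of_mem_edges hef
      rw [deleteEdges_adj] at h2 ⊢
      refine ⟨h2.1, ?_⟩
      intro h3
      rw [Set.mem_singleton_iff] at h3
      rw [h3] at hef
      exact hvw (w.fst_mem_support_of_mem_edges hef)
    have hlt : {y | (N.G.deleteEdges {s(c, c')}).Reachable c' y}.ncard < k := by
      rw [← hk]
      refine Set.ncard_lt_ncard ⟨hsub, ?_⟩ (Set.toFinite _)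
      intro hh
      have : v' ∈ {y | (N.G.deleteEdges {s(c, c')}).Reachable c' y} := hh (Reachable.refl v')
      exact hcb (hc'v.symm.trans (Reachable.symm this))
    obtain ⟨x, hx⟩ := ih _ hlt c c' rfl hcc hcb
    exact ⟨x, hsub _ hx⟩
  obtain ⟨w, hw, hwv⟩ : ∃ w, N.G.Adj v' w ∧ w ≠ v := by
    have h3 := hD.2 v' hleaf
    unfold degOf at h3
    obtain ⟨w, hw, hwv⟩ := Set.exists_ne_of_one_lt_ncard (s := N.G.neighborSet v') (by omega) v
    exact ⟨w, hw, hwv⟩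
  by_cases hbw : (N.G.deleteEdges {s(v', w)}).Reachable v' w
  · obtain ⟨C, hC, hCv, -⟩ := cycle_twoConn hw hbw
    obtain ⟨B, hB, hCB⟩ := exists_blob_ge hC
    have hv'B : v' ∈ B.verts := hCB.1 (C.edge_vert hCv)
    have hnB : ¬ B.Adj v v' := fun h => hb (hB.1.not_bridge h)
    have hvB : v ∉ B.verts := fun h => hb (sub_del_reach B (hB.1.conn h hv'B) hnB)
    obtain ⟨c, hcB, hcv', hcbr⟩ := other_nonbranch hB.1 (branch_le hB.1 (hlev B hB)) v'
    obtain ⟨c', hcc, hcn⟩ := out_edge hD hB.1 hcB (fun h => hcbr ⟨hcB, h⟩)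
    have hcb := blob_bridge hD hB hcB hcc hcn
    have h1 := sub_del_reach B (hB.1.conn hv'B hcB) hnB
    have h2 := sub_del_reach B (hB.1.conn hv'B hcB) hcn
    refine step c c' hcc hcb h1 h2 ?_
    rintro rfl
    refine hcb (h2.symm.trans (del_adj_reach hadj.symm ?_))
    intro e
    rw [Sym2.eq_iff] at e
    rcases e with e | e
    · exact hcv' e.1.symm
    · exact hvB (e.2 ▸ hcB)
  · exact step v' w hw hbw (Reachable.refl _) (Reachable.refl _) hwv

lemma forward {N : LabGraph X} (hN : N.IsNetwork) (hD : N.DegOK) (hleaves : N.AllLeavesInBlobs)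
    (a : X) {H : N.G.Subgraph} {u w : N.V}
    (hF : N.IsFormBlob H u w 1 0 0 0 (fun _ => a) Fin.elim0 Fin.elim0 Fin.elim0) :
    (∀ x : X, x ≠ a → 6 ≤ N.dm a x) ∧
        ∀ y z : X, y ≠ a → z ≠ a → N.dm y z + 8 ≤ N.dm a y + N.dm a z := by
  obtain ⟨⟨hH, e0, -, huniq⟩, -, hcut, hnt, hu, hw, -, -, -, -, -, -, -, -, -, -, -, -, -, -, hleaf,
    -, -, -, -, -, hside, -⟩ := hF
  have hconn := hN.1
  have huw : N.G.Adj u w := hcut.1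
  have hnuw : ¬ H.Adj u w := fun h => hw (H.edge_vert h.symm)
  have hb := blob_bridge hD hH hu huw hnuw
  have hleaf' : ∀ x, N.LeafInBlob x H ↔ x = a := by
    intro x
    rw [hleaf x]
    simp
  obtain ⟨p, hap, hp⟩ := (hleaf' a).2 rfl
  have haH : N.leaf a ∉ H.verts := fun h => hD.not_leaf hH.1 h a rfl
  -- p and its neighbours
  obtain ⟨m1, m2, hm12, hm1, hm2⟩ := hH.1.two_nbrs hp
  have hnbr : ∀ z, N.G.Adj p z → z ≠ N.leaf a → H.Adj p z := by
    intro z hz hza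
    rcases hD.mem3 hap.symm hm1.adj_sub hm2.adj_sub (fun e => haH (e ▸ H.edge_vert hm1.symm))
      (fun e => haH (e ▸ H.edge_vert hm2.symm)) hm12 hz with h | h | h
    · exact absurd h hza
    · exact h ▸ hm1
    · exact h ▸ hm2
  have hwleaf : ∀ x, N.leaf x ≠ w := fun x h => hnt ⟨x, by rw [h]; simp⟩
  have hpu : p ≠ u := by
    rintro rfl
    exact hnuw (hnbr w huw (hwleaf a).symm)
  have nonbr : ∀ z z', z ∈ H.verts → N.G.Adj z z' → z' ∉ H.verts → z ∉ N.branchVerts H := by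
    intro z z' hz hzz' hz' hbr
    have hsub : insert z' (H.neighborSet z) ⊆ N.G.neighborSet z := by
      rintro t (rfl | ht)
      · exact hzz'
      · exact H.neighborSet_subset z ht
    have h1 := Set.ncard_le_ncard hsub (Set.toFinite _)
    rw [Set.ncard_insert_of_notMem (show z' ∉ H.neighborSet z from
      fun h => hz' (H.edge_vert (Subgraph.Adj.symm h))) (Set.toFinite _)] at h1
    have := hD.le3 z
    have := hbr.2
    omega
  have hpbr := nonbr p _ hp hap.symm haH
  have hubr := nonbr u w hu huw hw
  have hnpu : ¬ N.G.Adj p u := by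
    intro h
    have h1 := hnbr u h (fun e => haH (e ▸ hu))
    refine hside 0 p hap ⟨⟨hp, hpbr⟩, ⟨hu, hubr⟩, ?_⟩
    apply Adj.reachable
    have : (H.deleteVerts (N.branchVerts H)).Adj p u := by
      rw [Subgraph.deleteVerts_adj]
      exact ⟨hp, hpbr, hu, hubr, h1⟩
    exact this
  -- distance from a to u
  have hau : 3 ≤ N.G.dist (N.leaf a) u := by
    obtain ⟨q, hq⟩ := hconn.exists_walk_length_eq_dist (N.leaf a) u
    rw [← hq]
    cases q with
    | nil => exact absurd hu haH
    | @cons _ c _ h q =>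
      obtain rfl := hD.leaf_nbr hap h
      cases q with
      | nil => exact absurd rfl hpu
      | @cons _ d _ h' q =>
        cases q with
        | nil => exact absurd h' hnpu
        | cons h'' q => simp
  -- a lies on the side of u
  have hua : (N.G.deleteEdges {s(u, w)}).Reachable u (N.leaf a) := by
    refine (sub_del_reach H (hH.1.conn hu hp) hnuw).trans (del_adj_reach hap.symm ?_)
    intro e
    rw [Sym2.eq_iff] at e
    rcases e with e | e
    · exact hwleaf a e.2
    · exact hw (e.1 ▸ hp)
  -- the others lie on the side of w
  have hwx : ∀ x, x ≠ a → (N.G.deleteEdges {s(u, w)}).Reachable w (N.leaf x) := by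
    intro x hxa
    have hxH : N.leaf x ∉ H.verts := fun h => hD.not_leaf hH.1 h x rfl
    obtain ⟨w0⟩ := hconn.preconnected (N.leaf x) p
    obtain ⟨v', v, w', hav, hv', hv, hadj⟩ := first_entry (S := H.verts) w0 hxH hp
    have hnt' : ¬ N.TrivialEdge s(v, v') := by
      rintro ⟨x', hx'⟩
      rw [Sym2.mem_iff] at hx'
      rcases hx' with h | h
      · exact hD.not_leaf hH.1 hv x' h
      · have hx'a : x' = a := (hleaf' x').1 ⟨v, by rw [h]; exact hadj, hv⟩
        subst hx'a
        obtain rfl := h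
        have hmem : ∀ z ∈ w'.reverse.support, z ∉ H.verts := by
          intro z hz
          rw [Walk.support_reverse, List.mem_reverse] at hz
          exact hav z hz
        generalize w'.reverse = r at hmem
        have hne : N.leaf x ≠ N.leaf x' := fun h => hxa (hN.2.1 h)
        clear w0 w' hav hxH
        generalize N.leaf x = lx at r hne
        cases r with
        | nil => exact hne rfl
        | @cons _ c _ h q =>
          obtain rfl := hD.leaf_nbr hap h
          exact hmem p (by simp) hp
    have hnB : ¬ H.Adj v v' := fun h => hv' (H.edge_vert h.symm)
    have hcut' : N.IsCutEdge s(v, v') := by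
      refine ⟨hadj.symm, fun hc => ?_⟩
      exact blob_bridge hD hH hv hadj.symm hnB (hc.preconnected v v')
    have e1 := huniq s(v, v') ⟨hcut', hnt', v, hv, by simp⟩
    have e2 := huniq s(u, w) ⟨hcut, hnt, u, hu, by simp⟩
    have e3 := e1.trans e2.symm
    rw [Sym2.eq_iff] at e3
    have hv'w : v' = w := by
      rcases e3 with e | e
      · exact e.2
      · exact absurd (e.1 ▸ hv) hw
    subst hv'w
    refine (del_reach w' ?_).symm
    intro h
    exact hav u (w'.fst_mem_support_of_mem_edges h) hu
  -- w is far from x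
  have hwd : ∀ x, x ≠ a → 2 ≤ N.G.dist w (N.leaf x) := by
    intro x hxa
    obtain ⟨q, hq⟩ := hconn.exists_walk_length_eq_dist (N.leaf x) w
    rw [SimpleGraph.dist_comm, ← hq]
    generalize hlx : N.leaf x = lx at q
    cases q with
    | nil => exact absurd hlx (hwleaf x)
    | @cons _ c _ h q =>
      cases q with
      | cons h' q => simp
      | nil =>
        exfalso
        subst hlx
        obtain ⟨H', hH', r, hr, hrH'⟩ := hleaves x
        obtain rfl := hD.leaf_nbr h hr
        obtain ⟨n1, n2, hn12, hn1, hn2⟩ := hH'.1.two_nbrs hrH'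
        have hxu : N.leaf x ≠ u := hD.not_leaf hH.1 hu x
        have nx : ∀ n, H'.Adj w n → n ≠ N.leaf x := fun n hn e =>
          hD.not_leaf hH'.1 (H'.edge_vert hn.symm) x e.symm
        have nu : ∀ n, H'.Adj w n → n ≠ u := by
          rintro n hn rfl
          exact hb (hH'.1.not_bridge hn.symm)
        have := hD.mem3 h.symm huw.symm hn1.adj_sub hxu (nx n1 hn1).symm (nu n1 hn1).symm hn2.adj_sub
        rcases this with e | e | e
        · exact nx n2 hn2 e
        · exact nu n2 hn2 e
        · exact hn12 e.symm
  have hmain : ∀ x, x ≠ a → 4 + N.G.dist w (N.leaf x) ≤ N.dm a x := by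
    intro x hxa
    unfold dm
    have h1 := dist_bridge hconn hb (hwx x hxa) hua
    have h2 := dist_bridge' hconn hb (hwx x hxa) (Reachable.refl u)
    have h3 : N.G.dist w u = 1 := dist_eq_one_iff_adj.2 huw.symm
    rw [SimpleGraph.dist_comm (u := u) (v := N.leaf a), SimpleGraph.dist_comm (u := N.leaf x) (v := N.leaf a)] at h1
    rw [SimpleGraph.dist_comm (u := N.leaf x) (v := w)] at h2
    omega
  refine ⟨fun x hxa => ?_, fun y z hy hz => ?_⟩
  · have := hmain x hxa
    have := hwd x hxa
    omega
  · have h1 := hmain y hy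
    have h2 := hmain z hz
    have h3 : N.dm y z ≤ N.G.dist (N.leaf y) w + N.G.dist w (N.leaf z) := hconn.dist_triangle
    rw [SimpleGraph.dist_comm (u := N.leaf y)] at h3
    omega

lemma nonbranch_two {N : LabGraph X} {B : N.G.Subgraph} {v n m k : N.V} (hv : v ∈ B.verts)
    (hbr : v ∉ N.branchVerts B) (hn : B.Adj v n) (hm : B.Adj v m) (hnm : n ≠ m) (hk : B.Adj v k) :
    k = n ∨ k = m := by
  by_contra hcon
  push Not at hcon
  apply hbr
  refine ⟨hv, ?_⟩
  have h3 : ({k, n, m} : Set N.V).ncard = 3 :=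
    Set.ncard_eq_three.2 ⟨k, n, m, hcon.1, hcon.2, hnm, rfl⟩
  rw [← h3]
  refine Set.ncard_le_ncard ?_ (Set.toFinite _)
  rintro z (rfl | rfl | rfl)
  · exact hk
  · exact hn
  · exact hm

lemma close_pair {N : LabGraph X} (hD : N.DegOK) {B : N.G.Subgraph} (hB : N.TwoConnSub B)
    (hbr : (N.branchVerts B).ncard ≤ 2) {p : N.V} (hp : p ∈ B.verts) (hpb : p ∉ N.branchVerts B) :
    (∃ v₁ v₂, v₁ ≠ v₂ ∧ (v₁ ∈ B.verts ∧ v₁ ≠ p ∧ v₁ ∉ N.branchVerts B) ∧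
      (v₂ ∈ B.verts ∧ v₂ ≠ p ∧ v₂ ∉ N.branchVerts B) ∧ N.G.dist p v₁ + N.G.dist p v₂ ≤ 4) ∨
    ∃ s t u, s ∈ N.branchVerts B ∧ t ∈ N.branchVerts B ∧ s ≠ t ∧ u ≠ p ∧ u ∉ N.branchVerts B ∧
      B.Adj p s ∧ B.Adj p t ∧ B.Adj s t ∧ B.Adj s u ∧ B.Adj t u := by
  have d1 : ∀ {x}, B.Adj p x → N.G.dist p x ≤ 1 := fun h =>
    dist_le (Walk.cons h.adj_sub Walk.nil)
  have d2 : ∀ {x y}, B.Adj p x → B.Adj x y → N.G.dist p y ≤ 2 := fun h h' =>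
    dist_le (Walk.cons h.adj_sub (Walk.cons h'.adj_sub Walk.nil))
  have d3 : ∀ {x y z}, B.Adj p x → B.Adj x y → B.Adj y z → N.G.dist p z ≤ 3 := fun h h' h'' =>
    dist_le (Walk.cons h.adj_sub (Walk.cons h'.adj_sub (Walk.cons h''.adj_sub Walk.nil)))
  have mem : ∀ {x y}, B.Adj x y → y ∈ B.verts := fun h => B.edge_vert h.symm
  -- one neighbour branch, the other not
  have mixed : ∀ q s, q ≠ s → B.Adj p q → B.Adj p s → q ∉ N.branchVerts B → s ∈ N.branchVerts B →
      ∃ v₁ v₂, v₁ ≠ v₂ ∧ (v₁ ∈ B.verts ∧ v₁ ≠ p ∧ v₁ ∉ N.branchVerts B) ∧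
      (v₂ ∈ B.verts ∧ v₂ ≠ p ∧ v₂ ∉ N.branchVerts B) ∧ N.G.dist p v₁ + N.G.dist p v₂ ≤ 4 := by
    intro q s hqs hpq hps hq hs
    have fin : ∀ v, B.Adj s v → v ≠ p → v ∉ N.branchVerts B → v ≠ q → _ := fun v hsv hvp hvb hvq =>
      (⟨q, v, hvq.symm, ⟨mem hpq, hpq.ne.symm, hq⟩, ⟨mem hsv, hvp, hvb⟩,
        by have := d1 hpq; have := d2 hps hsv; omega⟩ :
        ∃ v₁ v₂, v₁ ≠ v₂ ∧ (v₁ ∈ B.verts ∧ v₁ ≠ p ∧ v₁ ∉ N.branchVerts B) ∧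
      (v₂ ∈ B.verts ∧ v₂ ≠ p ∧ v₂ ∉ N.branchVerts B) ∧ N.G.dist p v₁ + N.G.dist p v₂ ≤ 4)
    -- the triangle situation
    have tri : ∀ t, t ∈ N.branchVerts B → B.Adj s t → t ≠ p → B.Adj s q → 
        ∃ v₁ v₂, v₁ ≠ v₂ ∧ (v₁ ∈ B.verts ∧ v₁ ≠ p ∧ v₁ ∉ N.branchVerts B) ∧
      (v₂ ∈ B.verts ∧ v₂ ≠ p ∧ v₂ ∉ N.branchVerts B) ∧ N.G.dist p v₁ + N.G.dist p v₂ ≤ 4 := by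
      intro t ht hst htp hsq
      obtain ⟨x, -, -, hxs, -, htx, -⟩ := branch_nbrs ht s
      have hxp : x ≠ p := by
        rintro rfl
        rcases nonbranch_two hp hpb hpq hps hqs htx.symm with h | h
        · exact hq (h ▸ ht)
        · exact hst.ne h.symm
      have hxq : x ≠ q := by
        rintro rfl
        rcases nonbranch_two (mem hpq) hq hpq.symm hsq.symm hps.ne htx.symm with h | h
        · exact htp h
        · exact hst.ne h.symm
      have hxb : x ∉ N.branchVerts B := fun h =>
        branch_three hbr hs ht h hst.ne hxs.symm htx.ne
      exact ⟨q, x, hxq.symm, ⟨mem hpq, hpq.ne.symm, hq⟩, ⟨mem htx, hxp, hxb⟩,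
        by have := d1 hpq; have := d3 hps hst htx; omega⟩
    obtain ⟨n, m, hnm, hnp, hmp, hsn, hsm⟩ := branch_nbrs hs p
    by_cases hnb : n ∈ N.branchVerts B
    · by_cases hmb : m ∈ N.branchVerts B
      · exact (branch_three hbr hs hnb hmb hsn.ne hsm.ne hnm).elim
      · by_cases hmq : m = q
        · exact tri n hnb hsn hnp (hmq ▸ hsm)
        · exact fin m hsm hmp hmb hmq
    · by_cases hnq : n = q
      · by_cases hmb : m ∈ N.branchVerts B
        · exact tri m hmb hsm hmp (hnq ▸ hsn)
        · exact fin m hsm hmp hmb (fun e => hnm (hnq.trans e.symm))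
      · exact fin n hsn hnp hnb hnq
  obtain ⟨q1, q2, hq12, h1, h2⟩ := hB.two_nbrs hp
  by_cases hb1 : q1 ∈ N.branchVerts B
  · by_cases hb2 : q2 ∈ N.branchVerts B
    · have third : ∀ x, x ∈ N.branchVerts B → x = q1 ∨ x = q2 := by
        intro x hx
        by_contra hcon
        push Not at hcon
        exact branch_three hbr hb1 hb2 hx hq12 hcon.1.symm hcon.2.symm
      have two : ∀ q q', B.Adj p q → q ∈ N.branchVerts B → (∀ x, x ∈ N.branchVerts B → x = q ∨ x = q') →
          (∃ v₁ v₂, v₁ ≠ v₂ ∧ (v₁ ∈ B.verts ∧ v₁ ≠ p ∧ v₁ ∉ N.branchVerts B) ∧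
          (v₂ ∈ B.verts ∧ v₂ ≠ p ∧ v₂ ∉ N.branchVerts B) ∧ N.G.dist p v₁ + N.G.dist p v₂ ≤ 4) ∨
          ∃ n, B.Adj q q' ∧ B.Adj q n ∧ n ≠ p ∧ n ∉ N.branchVerts B := by
        intro q q' hpq hq hth
        obtain ⟨n, m, hnm, hnp, hmp, hsn, hsm⟩ := branch_nbrs hq p
        by_cases hnb : n ∈ N.branchVerts B
        · have hn : n = q' := (hth n hnb).resolve_left hsn.ne.symm
          by_cases hmb : m ∈ N.branchVerts B
          · exact absurd (hn.trans ((hth m hmb).resolve_left hsm.ne.symm).symm) hnm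
          · exact Or.inr ⟨m, hn ▸ hsn, hsm, hmp, hmb⟩
        · by_cases hmb : m ∈ N.branchVerts B
          · have hm : m = q' := (hth m hmb).resolve_left hsm.ne.symm
            exact Or.inr ⟨n, hm ▸ hsm, hsn, hnp, hnb⟩
          · exact Or.inl ⟨n, m, hnm, ⟨mem hsn, hnp, hnb⟩, ⟨mem hsm, hmp, hmb⟩,
              by have := d2 hpq hsn; have := d2 hpq hsm; omega⟩
      rcases two q1 q2 h1 hb1 third with h | ⟨n, h12, hn, hnp, hnb⟩
      · exact Or.inl h
      rcases two q2 q1 h2 hb2 (fun x hx => (third x hx).symm) with h | ⟨m, -, hm, hmp, hmb⟩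
      · exact Or.inl h
      by_cases hnm : n = m
      · exact Or.inr ⟨q1, q2, n, hb1, hb2, hq12, hnp, hnb, h1, h2, h12, hn, hnm ▸ hm⟩
      · exact Or.inl ⟨n, m, hnm, ⟨mem hn, hnp, hnb⟩, ⟨mem hm, hmp, hmb⟩,
          by have := d2 h1 hn; have := d2 h2 hm; omega⟩
    · exact Or.inl (mixed q2 q1 hq12.symm h2 h1 hb2 hb1)
  · by_cases hb2 : q2 ∈ N.branchVerts B
    · exact Or.inl (mixed q1 q2 hq12 h1 h2 hb1 hb2)
    · exact Or.inl ⟨q1, q2, hq12, ⟨mem h1, h1.ne.symm, hb1⟩, ⟨mem h2, h2.ne.symm, hb2⟩,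
        by have := d1 h1; have := d1 h2; omega⟩

/-- two close non-branch vertices of the blob contradict the four-point condition -/
lemma pair_contra {N : LabGraph X} (hconn : N.G.Connected) (hD : N.DegOK) (hlev : N.IsLevel 2)
    {a : X} {B : N.G.Subgraph} (hB : N.IsBlob B) {p : N.V} (hap : N.G.Adj (N.leaf a) p)
    (hp : p ∈ B.verts) {v₁ v₂ : N.V} (hne : v₁ ≠ v₂)
    (h1 : v₁ ∈ B.verts ∧ v₁ ≠ p ∧ v₁ ∉ N.branchVerts B)
    (h2 : v₂ ∈ B.verts ∧ v₂ ≠ p ∧ v₂ ∉ N.branchVerts B)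
    (hd : N.G.dist p v₁ + N.G.dist p v₂ ≤ 4) :
    ∃ y z, y ≠ a ∧ z ≠ a ∧ N.dm a y + N.dm a z ≤ N.dm y z + 6 := by
  have haB : N.leaf a ∉ B.verts := fun h => hD.not_leaf hB.1 h a rfl
  have getleaf : ∀ v, (v ∈ B.verts ∧ v ≠ p ∧ v ∉ N.branchVerts B) → ∃ v' y, N.G.Adj v v' ∧
      ¬ B.Adj v v' ∧ ¬ (N.G.deleteEdges {s(v, v')}).Reachable v v' ∧
      (N.G.deleteEdges {s(v, v')}).Reachable v' (N.leaf y) ∧ y ≠ a ∧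
      N.dm a y ≤ 1 + N.G.dist p v + N.G.dist v (N.leaf y) := by
    intro v hv
    obtain ⟨v', hadj, hn⟩ := out_edge hD hB.1 hv.1 (fun h => hv.2.2 ⟨hv.1, h⟩)
    have hb := blob_bridge hD hB hv.1 hadj hn
    obtain ⟨y, hy⟩ := leaf_behind hD hlev _ v v' rfl hadj hb
    refine ⟨v', y, hadj, hn, hb, hy, ?_, ?_⟩
    · rintro rfl
      refine hb ((sub_del_reach B (hB.1.conn hv.1 hp) hn).trans
        ((del_adj_reach hap.symm ?_).trans hy.symm))
      intro e
      rw [Sym2.eq_iff] at e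
      rcases e with e | e
      · exact hv.2.1 e.1.symm
      · exact haB (e.2 ▸ hv.1)
    · unfold dm
      have t1 : N.G.dist (N.leaf a) (N.leaf y) ≤ N.G.dist (N.leaf a) p + N.G.dist p (N.leaf y) :=
        hconn.dist_triangle
      have t2 : N.G.dist p (N.leaf y) ≤ N.G.dist p v + N.G.dist v (N.leaf y) :=
        hconn.dist_triangle
      have t3 : N.G.dist (N.leaf a) p = 1 := dist_eq_one_iff_adj.2 hap
      omega
  obtain ⟨v1', y, hadj1, hn1, hb1, hy, hya, hdy⟩ := getleaf v₁ h1
  obtain ⟨v2', z, hadj2, hn2, hb2, hz, hza, hdz⟩ := getleaf v₂ h2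
  refine ⟨y, z, hya, hza, ?_⟩
  have hz1 : (N.G.deleteEdges {s(v₁, v1')}).Reachable v₁ (N.leaf z) := by
    refine (sub_del_reach B (hB.1.conn h1.1 h2.1) hn1).trans
      ((del_adj_reach hadj2 ?_).trans ?_)
    · intro e
      rw [Sym2.eq_iff] at e
      rcases e with e | e
      · exact hne e.1.symm
      · have : v2' ∈ B.verts := e.2 ▸ h1.1
        exact hb2 (sub_del_reach B (hB.1.conn h2.1 this) hn2)
    · obtain ⟨w⟩ := hz
      have hvw : v₁ ∉ w.support := by
        classical
        intro hvw
        exact hb2 ((sub_del_reach B (hB.1.conn h2.1 h1.1) hn2).trans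
          (w.takeUntil v₁ hvw).reachable.symm)
      refine walk_reach w ?_
      intro e f hef
      have h2 := w.adj_of_mem_edges hef
      rw [deleteEdges_adj] at h2 ⊢
      refine ⟨h2.1, ?_⟩
      intro h3
      rw [Set.mem_singleton_iff] at h3
      rw [h3] at hef
      exact hvw (w.fst_mem_support_of_mem_edges hef)
  have e1 := dist_bridge hconn hb1 hy hz1
  have e2 := dist_bridge hconn hb2 hz (sub_del_reach B (hB.1.conn h2.1 h1.1) hn2)
  unfold dm at *
  rw [SimpleGraph.dist_comm (u := N.leaf y) (v := v₁)] at e1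
  rw [SimpleGraph.dist_comm (u := N.leaf z) (v := v₂), SimpleGraph.dist_comm (u := N.leaf z) (v := v₁)] at e2
  omega

lemma backward {N : LabGraph X} (hN : N.IsNetwork) (hD : N.DegOK) (hlev : N.IsLevel 2)
    (hleaves : N.AllLeavesInBlobs) (a : X) (h6 : ∀ x : X, x ≠ a → 6 ≤ N.dm a x)
    (h8 : ∀ y z : X, y ≠ a → z ≠ a → N.dm y z + 8 ≤ N.dm a y + N.dm a z) :
    ∃ (H : N.G.Subgraph) (u w : N.V),
        N.IsFormBlob H u w 1 0 0 0 (fun _ => a) Fin.elim0 Fin.elim0 Fin.elim0 := by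
  have hconn := hN.1
  obtain ⟨B, hB, p, hap, hp⟩ := hleaves a
  have haB : N.leaf a ∉ B.verts := fun h => hD.not_leaf hB.1 h a rfl
  have mem : ∀ {x y}, B.Adj x y → y ∈ B.verts := fun h => B.edge_vert h.symm
  -- branch vertices have all their neighbours in the blob
  have full : ∀ z z', z ∈ N.branchVerts B → N.G.Adj z z' → B.Adj z z' := by
    intro z z' hbr hzz'
    have := Set.eq_of_subset_of_ncard_le (B.neighborSet_subset z)
      ((hD.le3 z).trans hbr.2) (Set.toFinite _)
    have h : z' ∈ N.G.neighborSet z := hzz'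
    rw [← this] at h
    exact h
  have hpb : p ∉ N.branchVerts B := fun h => haB (mem (full p _ h hap.symm))
  rcases close_pair hD hB.1 (branch_le hB.1 (hlev B hB)) hp hpb with
    ⟨v₁, v₂, hne, h1, h2, hd⟩ | ⟨s, t, u, hs, ht, hst, hup, hub, hps, hpt, hst', hsu, htu⟩
  · obtain ⟨y, z, hy, hz, hle⟩ := pair_contra hconn hD hlev hB hap hp hne h1 h2 hd
    have := h8 y z hy hz
    omega
  have hu : u ∈ B.verts := mem hsu
  obtain ⟨w, huw, hnuw⟩ := out_edge hD hB.1 hu (fun h => hub ⟨hu, h⟩)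
  have hb := blob_bridge hD hB hu huw hnuw
  have hw : w ∉ B.verts := fun h => hb (sub_del_reach B (hB.1.conn hu h) hnuw)
  -- neighbours
  have nbp : ∀ z, B.Adj p z → z = s ∨ z = t := fun z => nonbranch_two hp hpb hps hpt hst
  have nbu : ∀ z, B.Adj u z → z = s ∨ z = t := fun z => nonbranch_two hu hub hsu.symm htu.symm hst
  have nbs : ∀ z, B.Adj s z → z = p ∨ z = t ∨ z = u := fun z hz =>
    hD.mem3 hps.symm.adj_sub hst'.adj_sub hsu.adj_sub hpt.ne hup.symm htu.ne hz.adj_sub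
  have nbt : ∀ z, B.Adj t z → z = p ∨ z = s ∨ z = u := fun z hz =>
    hD.mem3 hpt.symm.adj_sub hst'.symm.adj_sub htu.adj_sub hps.ne hup.symm hsu.ne hz.adj_sub
  have hverts : ∀ z ∈ B.verts, z = p ∨ z = s ∨ z = t ∨ z = u := by
    intro z hz
    by_contra hcon
    obtain ⟨w0⟩ := hB.1.conn hz hp
    obtain ⟨v', v, -, -, hv', hv, hadj⟩ := first_entry (S := {z | z = p ∨ z = s ∨ z = t ∨ z = u}) w0
      hcon (Or.inl rfl)
    have hadj' : B.Adj v v' := Subgraph.Adj.symm hadj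
    apply hv'
    simp only [Set.mem_ofPred_eq]
    rcases hv with rfl | rfl | rfl | rfl
    · have := nbp v' hadj'; tauto
    · have := nbs v' hadj'; tauto
    · have := nbt v' hadj'; tauto
    · have := nbu v' hadj'; tauto
  -- all edges at the blob
  have gp : ∀ z, N.G.Adj p z → z = N.leaf a ∨ B.Adj p z := by
    intro z hz
    rcases hD.mem3 hap.symm hps.adj_sub hpt.adj_sub (fun e => haB (e ▸ mem hps))
      (fun e => haB (e ▸ mem hpt)) hst hz with h | h | h
    · exact Or.inl h
    · exact Or.inr (h ▸ hps)
    · exact Or.inr (h ▸ hpt)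
  have gu : ∀ z, N.G.Adj u z → z = w ∨ B.Adj u z := by
    intro z hz
    rcases hD.mem3 huw hsu.symm.adj_sub htu.symm.adj_sub (fun e => hw (e ▸ mem hps))
      (fun e => hw (e ▸ mem hpt)) hst hz with h | h | h
    · exact Or.inl h
    · exact Or.inr (h ▸ hsu.symm)
    · exact Or.inr (h ▸ htu.symm)
  have gall : ∀ v z, v ∈ B.verts → N.G.Adj v z →
      B.Adj v z ∨ (v = p ∧ z = N.leaf a) ∨ (v = u ∧ z = w) := by
    intro v z hv hz
    rcases hverts v hv with rfl | rfl | rfl | rfl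
    · have := gp z hz; tauto
    · exact Or.inl (full _ _ hs hz)
    · exact Or.inl (full _ _ ht hz)
    · have := gu z hz; tauto
  have hwleaf : ∀ x, N.leaf x ≠ w := by
    intro x hx
    have hxa : x ≠ a := by
      rintro rfl
      exact hup (hD.leaf_nbr (x := x) (by rw [hx]; exact huw.symm) hap)
    have h := h6 x hxa
    unfold dm at h
    rw [hx] at h
    have h' : N.G.dist (N.leaf a) w ≤ 4 :=
      dist_le (Walk.cons hap (Walk.cons hps.adj_sub (Walk.cons hsu.adj_sub (Walk.cons huw Walk.nil))))
    omega
  have hnt : ¬ N.TrivialEdge s(u, w) := by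
    rintro ⟨x, hx⟩
    rw [Sym2.mem_iff] at hx
    rcases hx with h | h
    · exact hD.not_leaf hB.1 hu x h
    · exact hwleaf x h
  have hcut : N.IsCutEdge s(u, w) := ⟨huw, fun hc => hb (hc.preconnected u w)⟩
  have hpend : N.IsPendantBlob B := by
    refine ⟨hB, s(u, w), ⟨hcut, hnt, u, hu, by simp⟩, ?_⟩
    rintro e ⟨hce, hnte, v, hv, hve⟩
    obtain ⟨z, rfl⟩ := Sym2.mem_iff_exists.1 hve
    have hvz : N.G.Adj v z := hce.1
    rcases gall v z hv hvz with h | ⟨-, h⟩ | ⟨h, h'⟩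
    · exfalso
      apply hce.2
      apply hconn.connected_delete_edge_of_not_isBridge
      rw [isBridge_iff, not_not]
      exact hB.1.not_bridge h
    · exact absurd ⟨a, by rw [h]; simp⟩ hnte
    · rw [h, h']
  have hrank : N.BlobRank B 2 := by
    have h1 := branch_ineq hB.1
    have h2 := hlev B hB
    have h3 : ({s, t} : Set N.V) ⊆ N.branchVerts B := by
      rintro z (rfl | rfl)
      · exact hs
      · exact ht
    have h4 := Set.ncard_le_ncard h3 (Set.toFinite _)
    rw [Set.ncard_pair hst] at h4
    unfold BlobRank
    omega
  have hmax : N.IsMaxChainT 1 (fun _ => a) := by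
    refine ⟨fun i h => by omega, ?_⟩
    intro l b hb hsub
    obtain ⟨⟨i, hi⟩, hia⟩ := hsub ⟨0, rfl⟩
    simp only at hia
    have far : ∀ x, N.dm a x ≠ 3 := by
      intro x hx
      by_cases hxa : x = a
      · subst hxa
        simp [dm] at hx
      · have := h6 x hxa
        omega
    have hl : l = 1 := by
      by_contra hl
      by_cases hi1 : i + 1 < l
      · have := hb i hi1
        rw [hia] at this
        exact far _ this
      · obtain ⟨j, rfl⟩ : ∃ j, i = j + 1 := ⟨i - 1, by omega⟩
        have := hb j hi
        rw [hia, dm, SimpleGraph.dist_comm] at this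
        exact far _ this
    subst hl
    refine Set.Subset.antisymm hsub ?_
    rintro x ⟨j, rfl⟩
    have : j = ⟨i, hi⟩ := Subsingleton.elim _ _
    rw [this, hia]
    exact ⟨0, rfl⟩
  have hleafiff : ∀ x, N.LeafInBlob x B ↔ x = a := by
    intro x
    constructor
    · rintro ⟨v, hxv, hv⟩
      rcases gall v _ hv hxv.symm with h | ⟨-, h⟩ | ⟨-, h⟩
      · exact absurd rfl (hD.not_leaf hB.1 (mem h) x)
      · exact hN.2.1 h
      · exact absurd h (hwleaf x)
    · rintro rfl
      exact ⟨p, hap, hp⟩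
  refine ⟨B, u, w, hpend, hrank, hcut, hnt, hu, hw, fun _ => hmax, fun h => absurd h (lt_irrefl _),
    fun h => absurd h (lt_irrefl _), fun h => absurd h (lt_irrefl _),
    fun i j _ => Subsingleton.elim i j, fun i => i.elim0, fun i => i.elim0, fun i => i.elim0,
    ?_, ?_, ?_, ?_, ?_, ?_, ?_, fun i h => by omega, fun i h => by omega, fun i h => by omega,
    fun i h => by omega, fun _ j => j.elim0, ?_, fun j => j.elim0, fun j => j.elim0,
    fun j => j.elim0, fun j => j.elim0⟩
  · simp
  · simp
  · simp
  · simp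
  · simp
  · simp
  · intro x
    rw [hleafiff x]
    simp
  · rintro i p' hp' ⟨h1, h2, h3⟩
    obtain rfl := hD.leaf_nbr hap hp'
    obtain ⟨q⟩ := h3
    have hne : (⟨p, h1⟩ : (B.deleteVerts (N.branchVerts B)).verts) ≠ ⟨u, h2⟩ :=
      fun e => hup (congrArg Subtype.val e).symm
    cases q with
    | nil => exact hne rfl
    | @cons _ c _ h q =>
      have h' : (B.deleteVerts (N.branchVerts B)).Adj p c := h
      rw [Subgraph.deleteVerts_adj] at h'
      rcases nbp _ h'.2.2.2.2 with e | e
      · exact h'.2.2.2.1 (e ▸ hs)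
      · exact h'.2.2.2.1 (e ▸ ht)

/-- Lemma 7: In a level-2 network with at least two blobs in which every leaf is
contained in a blob, the network contains a pendant level-2 blob of the form
`(1, 0, 0, 0)` containing the leaf `a` if and only if `d_m(a, x) ≥ 6` for all
`x ≠ a` and `d_m(a,y) + d_m(a,z) - d_m(y,z) ≥ 8` for any two leaves `y, z ≠ a`. -/
theorem pendant_level2_blob_1000_iff_distances
    (X : Type) [Fintype X] [DecidableEq X]
    (N : LabGraph X) (hN : N.IsNetwork) (hlev : N.IsLevel 2)
    (hblobs : N.TwoBlobs) (hleaves : N.AllLeavesInBlobs) (a : X) :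
    (∃ (H : N.G.Subgraph) (u w : N.V),
        N.IsFormBlob H u w 1 0 0 0 (fun _ => a) Fin.elim0 Fin.elim0 Fin.elim0) ↔
      ((∀ x : X, x ≠ a → 6 ≤ N.dm a x) ∧
        ∀ y z : X, y ≠ a → z ≠ a → N.dm y z + 8 ≤ N.dm a y + N.dm a z) := by
  have hD := degOK_of hN hblobs
  constructor
  · rintro ⟨H, u, w, hF⟩
    exact forward hN hD hleaves a hF
  · rintro ⟨h6, h8⟩
    exact backward hN hD hlev hleaves a h6 h8

end LabGraph
end
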